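/- arXiv:0803.2719 — 4 statements merged into one kernel-verified Lean document; each statement's English description precedes it below -/
import Mathlib

section
/- Let F and G be summable ball kernels and let v₀ ∈ D_0(ℚ_p). Then there exists v : ℚ_p × [0, ∞) → ℂ such that: (i) there exist a ball B₀ and γ₀ ∈ ℤ such that for every t ≥ 0 the function v(·, t) vanishes outside B₀, is constant on every ball of radius p^{γ₀}, and satisfies ∫ v(x, t) dμ(x) = 0; (ii) for every x ∈ ℚ_p the function t ↦ v(x, t) is continuously differentiable on [0, ∞); (iii) v(x, 0) = v₀(x) for all x; (iv) v satisfies the quadratic cascade equation for all x ∈ ℚ_p and all t > 0. -/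
open MeasureTheory

/-- The index (base-`p` logarithm of the radius) of the smallest ball of `ℚ_[p]`
containing the two points `x` and `y` (for `x ≠ y`): its radius is `‖x - y‖ = p ^ (-(x-y).valuation)`. -/
noncomputable def supIdx {p : ℕ} [Fact p.Prime] (x y : ℚ_[p]) : ℤ := -(x - y).valuation

/-- The index of the smallest ball containing the three points `x`, `ξ`, `η`
(for pairwise distinct points): its radius is `max (‖x-ξ‖, ‖x-η‖, ‖ξ-η‖)`. -/
noncomputable def sup3Idx {p : ℕ} [Fact p.Prime] (x ξ η : ℚ_[p]) : ℤ :=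
  max (supIdx x ξ) (max (supIdx x η) (supIdx ξ η))

/-- A ball kernel: a function on balls of `ℚ_[p]`, encoded as a function of a center and
an index (log_p of the radius), independent of the choice of center in the ball. -/
def IsBallKernel {p : ℕ} [Fact p.Prime] (F : ℚ_[p] → ℤ → ℂ) : Prop :=
  ∀ c c' : ℚ_[p], ∀ γ : ℤ, dist c c' ≤ (p : ℝ) ^ γ → F c γ = F c' γ

/-- Summability of a ball kernel: for every ball `B(c, p^γ₀)`,
`Σ_{γ > γ₀} ‖F(B(c, p^γ))‖ (p^γ - p^(γ-1)) < ∞`. -/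
def KernelSummable {p : ℕ} [Fact p.Prime] (F : ℚ_[p] → ℤ → ℂ) : Prop :=
  ∀ c : ℚ_[p], ∀ γ₀ : ℤ, Summable (fun n : ℕ =>
    ‖F c (γ₀ + 1 + n)‖ * ((p : ℝ) ^ (γ₀ + 1 + (n : ℤ)) - (p : ℝ) ^ (γ₀ + (n : ℤ))))

/-- An ultrametric wavelet with ball `B(c, p^γ)`: vanishes outside the ball, is constant
on each of the `p` maximal subballs (balls of radius `p^(γ-1)`), has zero mean, and is
not identically zero. -/
def IsWavelet {p : ℕ} [Fact p.Prime] [MeasurableSpace ℚ_[p]] (μ : Measure ℚ_[p])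
    (ψ : ℚ_[p] → ℂ) (c : ℚ_[p]) (γ : ℤ) : Prop :=
  (∀ x, (p : ℝ) ^ γ < dist x c → ψ x = 0) ∧
    (∀ x y, dist x y ≤ (p : ℝ) ^ (γ - 1) → ψ x = ψ y) ∧
    (∫ x, ψ x ∂μ) = 0 ∧ ψ ≠ 0

/-- The eigenvalue `λ_I = T(I) ν(I) + Σ_{J > I} T(J) (ν(J) - ν(J,I))` attached to the ball
`I = B(c, p^γI)` and the ball kernel `T`. -/
noncomputable def lamBall {p : ℕ} [Fact p.Prime] (T : ℚ_[p] → ℤ → ℂ) (c : ℚ_[p]) (γI : ℤ) : ℂ :=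
  T c γI * (((p : ℝ) ^ γI : ℝ) : ℂ) +
    ∑' n : ℕ, T c (γI + 1 + n) *
      (((p : ℝ) ^ (γI + 1 + (n : ℤ)) - (p : ℝ) ^ (γI + (n : ℤ)) : ℝ) : ℂ)

/-- The coefficient `Φ_{I,J}` for balls `J = B(c, p^γJ) ⊊ I = B(c, p^γI)`. -/
noncomputable def PhiIJ {p : ℕ} [Fact p.Prime] (F : ℚ_[p] → ℤ → ℂ) (c : ℚ_[p])
    (γI γJ : ℤ) : ℂ :=
  (((p : ℝ) ^ (2 * (γI - 1)) : ℝ) : ℂ) * F c γI - (((p : ℝ) ^ (2 * γJ) : ℝ) : ℂ) * F c γJ -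
    ∑ γ ∈ Finset.Ioo γJ γI, (((p : ℝ) ^ (2 * γ) - (p : ℝ) ^ (2 * γ - 2) : ℝ) : ℂ) * F c γ

/-- The (spatial) operator of the quadratic cascade equation:
`∫∫ F(sup(x,ξ,η)) f(ξ)(f(η) - f(x)) dμ(ξ) dμ(η) + ∫ G(sup(x,ξ))(f(x) - f(ξ)) dμ(ξ)`. -/
noncomputable def cascadeOp {p : ℕ} [Fact p.Prime] [MeasurableSpace ℚ_[p]]
    (μ : Measure ℚ_[p]) (F G : ℚ_[p] → ℤ → ℂ) (f : ℚ_[p] → ℂ) (x : ℚ_[p]) : ℂ :=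
  (∫ ξ, ∫ η, F x (sup3Idx x ξ η) * (f ξ * (f η - f x)) ∂μ ∂μ) +
    ∫ ξ, G x (supIdx x ξ) * (f x - f ξ) ∂μ

/-- `v` satisfies the quadratic cascade equation
`∂ₜ v(x,t) + ∫∫ F(sup(x,ξ,η)) v(ξ,t)(v(η,t) - v(x,t)) dμ(ξ) dμ(η)
  + ∫ G(sup(x,ξ))(v(x,t) - v(ξ,t)) dμ(ξ) = 0` for all `x ∈ ℚ_p` and all `t > 0`. -/
def SatisfiesCascade {p : ℕ} [Fact p.Prime] [MeasurableSpace ℚ_[p]]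
    (μ : Measure ℚ_[p]) (F G : ℚ_[p] → ℤ → ℂ) (v : ℚ_[p] → ℝ → ℂ) : Prop :=
  ∀ x : ℚ_[p], ∀ t : ℝ, 0 < t →
    HasDerivAt (fun s => v x s) (-(cascadeOp μ F G (fun y => v y t) x)) t


section Helpers

set_option linter.unusedSectionVars false

variable {p : ℕ} [Fact p.Prime]

/-- The closed ball of index `j` around `x`. -/
abbrev bl (x : ℚ_[p]) (j : ℤ) : Set ℚ_[p] := Metric.closedBall x ((p : ℝ) ^ j)

lemma one_lt_pR : (1 : ℝ) < (p : ℝ) := by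
  exact_mod_cast (Fact.out : p.Prime).one_lt

lemma pz_pos (j : ℤ) : (0 : ℝ) < (p : ℝ) ^ j :=
  zpow_pos (lt_trans zero_lt_one one_lt_pR) j

lemma pz_le {i j : ℤ} : (p : ℝ) ^ i ≤ (p : ℝ) ^ j ↔ i ≤ j :=
  zpow_le_zpow_iff_right₀ one_lt_pR

lemma dist_eq_supIdx {x y : ℚ_[p]} (h : y ≠ x) : dist x y = (p : ℝ) ^ supIdx x y := by
  rw [dist_eq_norm, Padic.norm_eq_zpow_neg_valuation (sub_ne_zero.2 h.symm)]
  rfl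

lemma mem_bl {x y : ℚ_[p]} {j : ℤ} : y ∈ bl x j ↔ dist x y ≤ (p : ℝ) ^ j := by
  rw [Metric.mem_closedBall, dist_comm]

lemma supIdx_le {x y : ℚ_[p]} (h : y ≠ x) {j : ℤ} : supIdx x y ≤ j ↔ y ∈ bl x j := by
  rw [mem_bl, dist_eq_supIdx h, pz_le]

lemma mem_bl_comm {x y : ℚ_[p]} {j : ℤ} : y ∈ bl x j ↔ x ∈ bl y j := by
  simp only [mem_bl, dist_comm]

lemma mem_bl_self (x : ℚ_[p]) (j : ℤ) : x ∈ bl x j :=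
  Metric.mem_closedBall_self (pz_pos j).le

lemma bl_eq {x y : ℚ_[p]} {j : ℤ} (h : y ∈ bl x j) : bl y j = bl x j :=
  (IsUltrametricDist.closedBall_eq_of_mem h).symm

lemma bl_mono (x : ℚ_[p]) {i j : ℤ} (h : i ≤ j) : bl x i ⊆ bl x j :=
  Metric.closedBall_subset_closedBall (pz_le.2 h)

lemma bl_trans {x y z : ℚ_[p]} {j : ℤ} (h : y ∈ bl x j) (h' : z ∈ bl y j) : z ∈ bl x j := by
  rwa [bl_eq h] at h'

lemma sup3_eq {x ξ η : ℚ_[p]} (h1 : ξ ≠ x) (h2 : η ≠ x) (h3 : η ≠ ξ) :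
    sup3Idx x ξ η = max (supIdx x ξ) (supIdx x η) := by
  have h : supIdx ξ η ≤ max (supIdx x ξ) (supIdx x η) := by
    rw [supIdx_le h3]
    have a : ξ ∈ bl x (max (supIdx x ξ) (supIdx x η)) := (supIdx_le h1).1 (le_max_left _ _)
    have b : η ∈ bl x (max (supIdx x ξ) (supIdx x η)) := (supIdx_le h2).1 (le_max_right _ _)
    rwa [bl_eq a]
  unfold sup3Idx
  rw [← max_assoc, max_eq_left h]

/-- If `y` lies in the ball of index `j` around `x` and `ξ` does not, the indices agree. -/
lemma supIdx_congr {x y ξ : ℚ_[p]} {j : ℤ} (h : y ∈ bl x j) (hξ : ξ ∉ bl x j) :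
    supIdx x ξ = supIdx y ξ ∧ j < supIdx x ξ := by
  have hx : ξ ≠ x := by rintro rfl; exact hξ (mem_bl_self _ _)
  have hy : ξ ≠ y := by rintro rfl; exact hξ h
  have h1 : j < supIdx x ξ := by
    by_contra hc
    exact hξ ((supIdx_le hx).1 (not_lt.1 hc))
  have h2 : j < supIdx y ξ := by
    by_contra hc
    exact hξ (bl_trans h ((supIdx_le hy).1 (not_lt.1 hc)))
  refine ⟨le_antisymm ?_ ?_, h1⟩
  · rw [supIdx_le hx]
    exact bl_trans (bl_mono _ h2.le h) ((supIdx_le hy).1 le_rfl)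
  · rw [supIdx_le hy]
    exact bl_trans (mem_bl_comm.1 (bl_mono _ h1.le h)) ((supIdx_le hx).1 le_rfl)

variable [MeasurableSpace ℚ_[p]] [BorelSpace ℚ_[p]]

lemma meas_bl (x : ℚ_[p]) (j : ℤ) : MeasurableSet (bl x j) :=
  Metric.isClosed_closedBall.measurableSet

lemma isCompact_bl (x : ℚ_[p]) (j : ℤ) : IsCompact (bl x j) := isCompact_closedBall _ _

variable (μ : Measure ℚ_[p]) [μ.IsAddHaarMeasure]

lemma μ_bl_zero (x : ℚ_[p]) (j : ℤ) : μ (bl x j) = μ (bl 0 j) := by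
  have : bl x j = (fun h => (-x) + h) ⁻¹' bl 0 j := by
    ext y
    simp [add_comm, sub_eq_add_neg]
  rw [this, measure_preimage_add]

lemma bl_succ_eq (j : ℤ) : bl (0 : ℚ_[p]) (j + 1) =
    ⋃ k : Fin p, bl (((k : ℕ) : ℚ_[p]) * (p : ℚ_[p]) ^ (-(j + 1))) j := by
  have hp0 : (p : ℚ_[p]) ≠ 0 := by exact_mod_cast (Fact.out : p.Prime).ne_zero
  ext x
  simp only [Set.mem_iUnion, mem_closedBall_iff_norm, sub_zero]
  constructor
  · intro hx
    have h1 : ‖x * (p : ℚ_[p]) ^ (j + 1)‖ ≤ 1 := by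
      rw [norm_mul, Padic.norm_p_zpow]
      calc ‖x‖ * (p : ℝ) ^ (-(j + 1)) ≤ (p : ℝ) ^ (j + 1) * (p : ℝ) ^ (-(j + 1)) := by
            gcongr
        _ = 1 := by
            rw [zpow_neg, mul_inv_cancel₀ (pz_pos _).ne']
    obtain ⟨z, hz⟩ : ∃ z : ℤ_[p], (z : ℚ_[p]) = x * (p : ℚ_[p]) ^ (j + 1) := ⟨⟨_, h1⟩, rfl⟩
    obtain ⟨n, hn, hm⟩ := PadicInt.exists_mem_range z
    refine ⟨⟨n, hn⟩, ?_⟩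
    rw [PadicInt.maximalIdeal_eq_span_p, Ideal.mem_span_singleton, ← PadicInt.norm_lt_one_iff_dvd,
      PadicInt.norm_def] at hm
    have h2 : x - n * (p : ℚ_[p]) ^ (-(j + 1)) =
        (x * (p : ℚ_[p]) ^ (j + 1) - n) * (p : ℚ_[p]) ^ (-(j + 1)) := by
      rw [sub_mul, mul_assoc, zpow_neg, mul_inv_cancel₀ (zpow_ne_zero _ hp0), mul_one]
    rw [Padic.norm_le_pow_iff_norm_lt_pow_add_one, h2, norm_mul, Padic.norm_p_zpow, neg_neg]
    have h3 : ‖x * (p : ℚ_[p]) ^ (j + 1) - n‖ < 1 := by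
      rw [PadicInt.coe_sub, PadicInt.coe_natCast, hz] at hm
      exact hm
    calc _ < 1 * (p : ℝ) ^ (j + 1) := by
          gcongr
          exact pz_pos _
      _ = _ := one_mul _
  · rintro ⟨k, hk⟩
    have h1 : ‖((k : ℕ) : ℚ_[p]) * (p : ℚ_[p]) ^ (-(j + 1))‖ ≤ (p : ℝ) ^ (j + 1) := by
      rw [norm_mul, Padic.norm_p_zpow, neg_neg]
      have : ‖((k : ℕ) : ℚ_[p])‖ ≤ 1 := by simpa using Padic.norm_int_le_one ((k : ℕ) : ℤ)
      calc _ ≤ 1 * (p : ℝ) ^ (j + 1) := by gcongr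
        _ = _ := one_mul _
    have h2 := IsUltrametricDist.norm_add_le_max (x - ((k : ℕ) : ℚ_[p]) * (p : ℚ_[p]) ^ (-(j + 1)))
      (((k : ℕ) : ℚ_[p]) * (p : ℚ_[p]) ^ (-(j + 1)))
    rw [sub_add_cancel] at h2
    exact h2.trans (max_le (hk.trans (pz_le.2 (by omega))) h1)

lemma μ_bl_succ (j : ℤ) : μ (bl (0 : ℚ_[p]) (j + 1)) = p * μ (bl 0 j) := by
  have hp0 : (p : ℚ_[p]) ≠ 0 := by exact_mod_cast (Fact.out : p.Prime).ne_zero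
  rw [bl_succ_eq, measure_iUnion]
  · simp_rw [μ_bl_zero μ _ j]
    simp
  · intro a b hab
    refine (IsUltrametricDist.closedBall_eq_or_disjoint _ _ _).resolve_left ?_
    intro he
    have h1 : (((a : ℕ) : ℚ_[p]) * (p : ℚ_[p]) ^ (-(j + 1))) ∈
        bl (((b : ℕ) : ℚ_[p]) * (p : ℚ_[p]) ^ (-(j + 1))) j := by
      have h0 := mem_bl_self (((a : ℕ) : ℚ_[p]) * (p : ℚ_[p]) ^ (-(j + 1))) j
      rwa [bl, he] at h0
    rw [mem_closedBall_iff_norm, ← sub_mul, Padic.norm_le_pow_iff_norm_lt_pow_add_one, norm_mul,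
      Padic.norm_p_zpow, neg_neg] at h1
    have h2 : ‖((a : ℕ) : ℚ_[p]) - ((b : ℕ) : ℚ_[p])‖ < 1 := by
      by_contra hc
      have := mul_le_mul_of_nonneg_right (not_lt.1 hc) (pz_pos (p := p) (j + 1)).le
      linarith
    have h3 : ‖(((a : ℕ) - (b : ℕ) : ℤ) : ℚ_[p])‖ < 1 := by push_cast; exact h2
    rw [Padic.norm_intCast_lt_one_iff] at h3
    apply hab
    have ha := a.2
    have hb := b.2
    have := Int.eq_zero_of_abs_lt_dvd h3 (by rw [abs_lt]; constructor <;> omega)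
    ext
    omega
  · intro k
    exact meas_bl _ _

lemma μr_bl (hμ : μ (Metric.closedBall 0 1) = 1) (x : ℚ_[p]) (j : ℤ) :
    μ.real (bl x j) = (p : ℝ) ^ j := by
  have hp0 : (p : ℝ) ≠ 0 := (lt_trans zero_lt_one one_lt_pR).ne'
  rw [Measure.real, μ_bl_zero, ← Measure.real]
  have hs : ∀ j : ℤ, μ.real (bl (0 : ℚ_[p]) (j + 1)) = p * μ.real (bl (0 : ℚ_[p]) j) := by
    intro j
    simp [Measure.real, μ_bl_succ, ENNReal.toReal_mul]
  induction j with
  | zero => simp [Measure.real, bl, hμ]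
  | succ n ih => rw [hs, ih, zpow_add_one₀ hp0, mul_comm]
  | pred n ih =>
    have := hs (-(n : ℤ) - 1)
    rw [sub_add_cancel, ih] at this
    rw [zpow_sub_one₀ hp0, this]
    field_simp

lemma cont_of_lc {f : ℚ_[p] → ℂ} {j : ℤ} (h : ∀ x y, dist x y ≤ (p : ℝ) ^ j → f x = f y) :
    Continuous f := by
  rw [continuous_iff_continuousAt]
  intro x
  have : (fun _ => f x) =ᶠ[nhds x] f := by
    filter_upwards [Metric.closedBall_mem_nhds x (pz_pos (p := p) j)] with y hy
    exact h x y (by rwa [dist_comm])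
  exact continuousAt_const.congr this

lemma integrableOn_bl {f : ℚ_[p] → ℂ} (hf : Continuous f) (x : ℚ_[p]) (j : ℤ) :
    IntegrableOn f (bl x j) μ :=
  hf.continuousOn.integrableOn_compact (isCompact_bl x j)

lemma integrable_of_supp {f : ℚ_[p] → ℂ} (hf : Continuous f) {x : ℚ_[p]} {j : ℤ}
    (hs : ∀ y, y ∉ bl x j → f y = 0) : Integrable f μ := by
  rw [← integrableOn_iff_integrable_of_support_subset (s := bl x j)]
  · exact integrableOn_bl μ hf x j
  · intro y hy
    by_contra hc
    exact hy (hs y hc)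

lemma setInt_translate (g : ℚ_[p] → ℂ) (y : ℚ_[p]) (i : ℤ) :
    ∫ z in bl y i, g z ∂μ = ∫ w in bl (0 : ℚ_[p]) i, g (w + y) ∂μ := by
  have h := (measurePreserving_add_right μ y).setIntegral_preimage_emb
    (measurableEmbedding_addRight y) g (bl y i)
  rw [← h]
  congr 2
  ext w
  simp

lemma setInt_translate' (g : ℚ_[p] → ℂ) (x w : ℚ_[p]) (j : ℤ) (hw : w ∈ bl (0 : ℚ_[p]) j) :
    ∫ y in bl x j, g (w + y) ∂μ = ∫ y in bl x j, g y ∂μ := by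
  have h := (measurePreserving_add_left μ w).setIntegral_preimage_emb
    (measurableEmbedding_addLeft w) g (bl x j)
  rw [← h]
  have : (fun y => w + y) ⁻¹' (bl x j) = bl x j := by
    ext y
    have h1 : w + y ∈ bl y j := by
      rw [mem_closedBall_iff_norm] at hw ⊢
      simpa using hw
    constructor
    · intro h2
      exact bl_trans h2 (mem_bl_comm.1 h1)
    · intro h2
      exact bl_trans h2 h1
  rw [this]

lemma tower {g : ℚ_[p] → ℂ} (hg : Continuous g) (x : ℚ_[p]) {i j : ℤ} (hij : i ≤ j) :
    ∫ y in bl x j, ∫ z in bl y i, g z ∂μ ∂μ =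
      (μ.real (bl (0 : ℚ_[p]) i) : ℂ) * ∫ y in bl x j, g y ∂μ := by
  simp_rw [setInt_translate μ g _ i]
  rw [integral_integral_swap]
  · rw [setIntegral_congr_fun (g := fun _ => ∫ y in bl x j, g y ∂μ) (meas_bl _ _)]
    · rw [setIntegral_const]
      simp
    · intro w hw
      exact setInt_translate' μ g x w j (bl_mono _ hij hw)
  · rw [Measure.prod_restrict]
    apply ContinuousOn.integrableOn_compact ((isCompact_bl _ _).prod (isCompact_bl _ _))
    apply Continuous.continuousOn
    unfold Function.uncurry
    fun_prop

lemma supIdx_shell {x η : ℚ_[p]} {j : ℤ} (h1 : η ∈ bl x (j + 1)) (h2 : η ∉ bl x j) :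
    supIdx x η = j + 1 := by
  have hx : η ≠ x := by rintro rfl; exact h2 (mem_bl_self _ _)
  have h3 := (supIdx_le hx).2 h1
  have h4 := (supIdx_congr (mem_bl_self x j) h2).2
  omega

lemma compl_bl (x : ℚ_[p]) (ρ : ℤ) :
    (bl x ρ)ᶜ = ⋃ n : ℕ, (bl x (ρ + n + 1) \ bl x (ρ + n)) := by
  ext η
  simp only [Set.mem_iUnion, Set.mem_compl_iff, Set.mem_sdiff]
  constructor
  · intro h
    have hx : η ≠ x := by rintro rfl; exact h (mem_bl_self _ _)
    have h4 := (supIdx_congr (mem_bl_self x ρ) h).2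
    refine ⟨(supIdx x η - ρ - 1).toNat, ?_, ?_⟩
    · rw [← supIdx_le hx]
      omega
    · rw [← supIdx_le hx]
      omega
  · rintro ⟨n, -, h⟩ hc
    exact h (bl_mono x (by omega) hc)

lemma integrable_inf (hμ : μ (Metric.closedBall 0 1) = 1) {F : ℚ_[p] → ℤ → ℂ}
    (hFs : KernelSummable F) (x : ℚ_[p]) (ρ : ℤ) :
    IntegrableOn (fun η => F x (supIdx x η)) (bl x ρ)ᶜ μ := by
  rw [compl_bl]
  have hm : ∀ n : ℕ, MeasurableSet (bl x (ρ + n + 1) \ bl x (ρ + n)) := fun n =>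
    (meas_bl _ _).diff (meas_bl _ _)
  have hc : ∀ n : ℕ, Set.EqOn (fun _ => F x (ρ + n + 1)) (fun η => F x (supIdx x η))
      (bl x (ρ + n + 1) \ bl x (ρ + n)) := by
    intro n η hη
    simp only
    rw [supIdx_shell hη.1 hη.2]
  have hfin : ∀ n : ℕ, μ (bl x (ρ + n + 1) \ bl x (ρ + n)) ≠ ⊤ := fun n =>
    ((measure_mono Set.sdiff_subset).trans_lt (isCompact_bl _ _).measure_lt_top).ne
  apply integrableOn_iUnion_of_summable_integral_norm
  · intro n
    exact (integrableOn_const (hs := hfin n)).congr_fun (hc n) (hm n)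
  · have h := hFs x ρ
    refine h.congr ?_
    intro n
    have e : ∫ η in bl x (ρ + n + 1) \ bl x (ρ + n), ‖F x (supIdx x η)‖ ∂μ =
        ∫ η in bl x (ρ + n + 1) \ bl x (ρ + n), ‖F x (ρ + n + 1)‖ ∂μ := by
      apply setIntegral_congr_fun (hm n)
      intro η hη
      simp only
      rw [supIdx_shell hη.1 hη.2]
    rw [e, setIntegral_const, measureReal_sdiff (bl_mono x (by omega)) (meas_bl _ _)
      (isCompact_bl _ _).measure_lt_top.ne, μr_bl μ hμ, μr_bl μ hμ, smul_eq_mul, mul_comm,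
      show ρ + n + 1 = ρ + 1 + n by ring]

/-- `g` is integrable with integral `I`. -/
def HI (g : ℚ_[p] → ℂ) (I : ℂ) : Prop := Integrable g μ ∧ ∫ x, g x ∂μ = I

variable {μ} in
lemma HI.add {g h : ℚ_[p] → ℂ} {I J : ℂ} (hg : HI μ g I) (hh : HI μ h J) :
    HI μ (fun x => g x + h x) (I + J) :=
  ⟨hg.1.add hh.1, by rw [integral_add hg.1 hh.1, hg.2, hh.2]⟩

variable {μ} in
lemma HI.mul {g : ℚ_[p] → ℂ} {I : ℂ} (hg : HI μ g I) (c : ℂ) :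
    HI μ (fun x => c * g x) (c * I) :=
  ⟨hg.1.const_mul c, by rw [integral_const_mul, hg.2]⟩

variable {μ} in
lemma HI.sum {N : ℕ} {g : ℕ → ℚ_[p] → ℂ} {I : ℕ → ℂ} (hg : ∀ i, HI μ (g i) (I i)) :
    HI μ (fun x => ∑ i ∈ Finset.range N, g i x) (∑ i ∈ Finset.range N, I i) :=
  ⟨integrable_finsetSum _ fun i _ => (hg i).1, by
    rw [integral_finsetSum _ fun i _ => (hg i).1]
    exact Finset.sum_congr rfl fun i _ => (hg i).2⟩

variable {μ} in
lemma HI.ind {g : ℚ_[p] → ℂ} {s : Set ℚ_[p]} (hs : MeasurableSet s) (hg : IntegrableOn g s μ) :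
    HI μ (s.indicator g) (∫ x in s, g x ∂μ) :=
  ⟨hg.integrable_indicator hs, integral_indicator hs⟩

lemma step_rep (Φ : ℤ → ℂ) (ρ : ℤ) (N : ℕ) (s : ℤ) (h1 : ρ - N ≤ s) (h2 : s ≤ ρ) :
    Φ s = Φ ρ + ∑ i ∈ Finset.range N, (Φ (ρ - (i + 1 : ℕ)) - Φ (ρ - i)) *
      (if s ≤ ρ - (i + 1 : ℕ) then 1 else 0) := by
  obtain ⟨k, rfl⟩ : ∃ k : ℕ, s = ρ - k := ⟨(ρ - s).toNat, by omega⟩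
  have hk : k ≤ N := by omega
  have : ∀ i ∈ Finset.range N, (Φ (ρ - (i + 1 : ℕ)) - Φ (ρ - i)) *
      (if ρ - (k : ℤ) ≤ ρ - (i + 1 : ℕ) then (1 : ℂ) else 0) =
      if i < k then (Φ (ρ - (i + 1 : ℕ)) - Φ (ρ - i)) else 0 := by
    intro i _
    have : (ρ - (k : ℤ) ≤ ρ - (i + 1 : ℕ)) ↔ i < k := by omega
    simp only [this]
    split_ifs <;> simp
  rw [Finset.sum_congr rfl this, ← Finset.sum_filter]
  have h3 : (Finset.range N).filter (fun i => i < k) = Finset.range k := by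
    ext i; simp; omega
  rw [h3, Finset.sum_range_sub (fun i : ℕ => Φ (ρ - i))]
  simp

lemma ae_ne' (x : ℚ_[p]) : ∀ᵐ ξ ∂μ, ξ ≠ x :=
  compl_mem_ae_iff.2 (measure_singleton x)

/-- `∫_{B_i} (f - f x)`. -/
lemma int_sub_const (hμ : μ (Metric.closedBall 0 1) = 1) {f : ℚ_[p] → ℂ} (hf : Continuous f)
    (x : ℚ_[p]) (j : ℤ) (a : ℂ) : ∫ y in bl x j, (f y - a) ∂μ =
      (∫ y in bl x j, f y ∂μ) - (((p : ℝ) ^ j : ℝ) : ℂ) * a := by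
  rw [integral_sub (integrableOn_bl μ hf x j) (integrableOn_bl μ continuous_const x j),
    setIntegral_const, μr_bl μ hμ]
  simp

lemma op_F (hμ : μ (Metric.closedBall 0 1) = 1) {F : ℚ_[p] → ℤ → ℂ}
    (hFs : KernelSummable F) {f : ℚ_[p] → ℂ} (hf : Continuous f) (x : ℚ_[p]) (ρ : ℤ) (N : ℕ)
    (hsupp : ∀ y, y ∉ bl x ρ → f y = 0) (hlc : ∀ y, y ∈ bl x (ρ - N) → f y = f x)
    (hmean : ∫ y, f y ∂μ = 0) :
    ∫ ξ, ∫ η, F x (sup3Idx x ξ η) * (f ξ * (f η - f x)) ∂μ ∂μ =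
      ∑ i ∈ Finset.range N, (F x (ρ - (i + 1 : ℕ)) - F x (ρ - i)) *
        (∫ y in bl x (ρ - (i + 1 : ℕ)), f y ∂μ) *
        ((∫ y in bl x (ρ - (i + 1 : ℕ)), f y ∂μ) -
          (((p : ℝ) ^ (ρ - (i + 1 : ℕ)) : ℝ) : ℂ) * f x) := by
  classical
  set C : ℂ := ∫ η in (bl x ρ)ᶜ, F x (supIdx x η) ∂μ with hC
  set T : ℤ → ℂ := fun j => ∫ y in bl x j, (f y - f x) ∂μ with hT
  set c : ℕ → ℂ := fun i => F x (ρ - (i + 1 : ℕ)) - F x (ρ - i) with hc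
  have hu : Continuous (fun y => f y - f x) := hf.sub continuous_const
  -- the inner integral
  have inner : ∀ ξ, ξ ≠ x → ∫ η, F x (sup3Idx x ξ η) * (f ξ * (f η - f x)) ∂μ =
      (F x ρ * T ρ - f x * C) * f ξ + ∑ i ∈ Finset.range N,
        (c i * T (ρ - (i + 1 : ℕ))) * (bl x (ρ - (i + 1 : ℕ))).indicator f ξ := by
    intro ξ hξ
    by_cases hξB : ξ ∈ bl x ρ
    · have h1 : HI μ (fun η => f ξ * ((F x ρ * (bl x ρ).indicator (fun y => f y - f x) η +
          ∑ i ∈ Finset.range N, (c i * (if ξ ∈ bl x (ρ - (i + 1 : ℕ)) then 1 else 0)) *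
            (bl x (ρ - (i + 1 : ℕ))).indicator (fun y => f y - f x) η) +
          (-f x) * ((bl x ρ)ᶜ).indicator (fun η => F x (supIdx x η)) η)) _ :=
        ((((HI.ind (meas_bl x ρ) (integrableOn_bl μ hu x ρ)).mul (F x ρ)).add
          (HI.sum fun i => (HI.ind (meas_bl x (ρ - (i + 1 : ℕ)))
            (integrableOn_bl μ hu x (ρ - (i + 1 : ℕ)))).mul
              (c i * (if ξ ∈ bl x (ρ - (i + 1 : ℕ)) then 1 else 0)))).add
          ((HI.ind (meas_bl x ρ).compl (integrable_inf μ hμ hFs x ρ)).mul (-f x))).mul (f ξ)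
      rw [integral_congr_ae (g := fun η => f ξ * ((F x ρ *
          (bl x ρ).indicator (fun y => f y - f x) η +
          ∑ i ∈ Finset.range N, (c i * (if ξ ∈ bl x (ρ - (i + 1 : ℕ)) then 1 else 0)) *
            (bl x (ρ - (i + 1 : ℕ))).indicator (fun y => f y - f x) η) +
          (-f x) * ((bl x ρ)ᶜ).indicator (fun η => F x (supIdx x η)) η)), h1.2]
      · change f ξ * ((F x ρ * T ρ + ∑ i ∈ Finset.range N,
          (c i * (if ξ ∈ bl x (ρ - (i + 1 : ℕ)) then 1 else 0)) * T (ρ - (i + 1 : ℕ))) +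
          (-f x) * C) = _
        have : ∀ i ∈ Finset.range N,
            (c i * T (ρ - (i + 1 : ℕ))) * (bl x (ρ - (i + 1 : ℕ))).indicator f ξ =
            f ξ * ((c i * (if ξ ∈ bl x (ρ - (i + 1 : ℕ)) then 1 else 0)) *
              T (ρ - (i + 1 : ℕ))) := by
          intro i _
          by_cases h : ξ ∈ bl x (ρ - (i + 1 : ℕ))
          · rw [Set.indicator_of_mem h, if_pos h]; ring
          · rw [Set.indicator_of_notMem h, if_neg h]; ring
        rw [Finset.sum_congr rfl this, ← Finset.mul_sum]
        ring
      · filter_upwards [ae_ne' μ x, ae_ne' μ ξ] with η h2 h3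
        rw [sup3_eq hξ h2 h3]
        by_cases hη : η ∈ bl x ρ
        · rw [Set.indicator_of_mem hη, Set.indicator_of_notMem (by simpa using hη)]
          by_cases hs : ρ - N ≤ max (supIdx x ξ) (supIdx x η)
          · rw [step_rep (F x) ρ N _ hs (max_le ((supIdx_le hξ).2 hξB) ((supIdx_le h2).2 hη))]
            have : ∀ i ∈ Finset.range N,
                (c i * (if ξ ∈ bl x (ρ - (i + 1 : ℕ)) then 1 else 0)) *
                  (bl x (ρ - (i + 1 : ℕ))).indicator (fun y => f y - f x) η =
                (F x (ρ - (i + 1 : ℕ)) - F x (ρ - i)) *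
                  (if max (supIdx x ξ) (supIdx x η) ≤ ρ - (i + 1 : ℕ) then 1 else 0) *
                  (f η - f x) := by
              intro i _
              simp only [max_le_iff, supIdx_le hξ, supIdx_le h2, hc]
              by_cases ha : ξ ∈ bl x (ρ - (i + 1 : ℕ)) <;>
              by_cases hb : η ∈ bl x (ρ - (i + 1 : ℕ)) <;>
              simp only [ha, hb, Set.indicator_of_mem, Set.indicator_of_notMem, if_true, if_false,
                and_true, and_false, not_false_eq_true] <;> ring
            rw [Finset.sum_congr rfl this, ← Finset.sum_mul]
            ring
          · have hz : f η - f x = 0 := by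
              rw [hlc η ((supIdx_le h2).1 (le_trans (le_max_right _ _) (not_le.1 hs).le)), sub_self]
            have : ∀ i ∈ Finset.range N,
                (c i * (if ξ ∈ bl x (ρ - (i + 1 : ℕ)) then 1 else 0)) *
                  (bl x (ρ - (i + 1 : ℕ))).indicator (fun y => f y - f x) η = 0 := by
              intro i _
              by_cases hb : η ∈ bl x (ρ - (i + 1 : ℕ))
              · rw [Set.indicator_of_mem hb, hz, mul_zero]
              · rw [Set.indicator_of_notMem hb, mul_zero]
            rw [Finset.sum_congr rfl this, hz]
            simp
        · have hlt := (supIdx_congr (mem_bl_self x ρ) hη).2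
          have hle := (supIdx_le hξ).2 hξB
          rw [Set.indicator_of_notMem hη, Set.indicator_of_mem (by simpa using hη),
            max_eq_right (hle.trans hlt.le), hsupp η hη]
          have : ∀ i ∈ Finset.range N,
              (c i * (if ξ ∈ bl x (ρ - (i + 1 : ℕ)) then 1 else 0)) *
                (bl x (ρ - (i + 1 : ℕ))).indicator (fun y => f y - f x) η = 0 := by
            intro i _
            rw [Set.indicator_of_notMem (fun hb => hη (bl_mono x (by omega) hb)), mul_zero]
          rw [Finset.sum_congr rfl this]
          simp
          ring
    · have hz := hsupp ξ hξB
      have : ∀ i ∈ Finset.range N,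
          (c i * T (ρ - (i + 1 : ℕ))) * (bl x (ρ - (i + 1 : ℕ))).indicator f ξ = 0 := by
        intro i _
        rw [Set.indicator_of_notMem (fun hb => hξB (bl_mono x (by omega) hb)), mul_zero]
      rw [Finset.sum_congr rfl this, hz]
      simp
  have outer : HI μ (fun ξ => (F x ρ * T ρ - f x * C) * f ξ + ∑ i ∈ Finset.range N,
        (c i * T (ρ - (i + 1 : ℕ))) * (bl x (ρ - (i + 1 : ℕ))).indicator f ξ) _ :=
    (HI.mul ⟨integrable_of_supp μ hf hsupp, hmean⟩ (F x ρ * T ρ - f x * C)).add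
      (HI.sum fun i => (HI.ind (meas_bl x (ρ - (i + 1 : ℕ)))
            (integrableOn_bl μ hf x (ρ - (i + 1 : ℕ)))).mul (c i * T (ρ - (i + 1 : ℕ))))
  rw [integral_congr_ae ((ae_ne' μ x).mono inner), outer.2, mul_zero, zero_add]
  apply Finset.sum_congr rfl
  intro i _
  simp only [hT, int_sub_const μ hμ hf, hc]
  ring

lemma op_G (hμ : μ (Metric.closedBall 0 1) = 1) {G : ℚ_[p] → ℤ → ℂ}
    (hGs : KernelSummable G) {f : ℚ_[p] → ℂ} (hf : Continuous f) (x : ℚ_[p]) (ρ : ℤ) (N : ℕ)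
    (hsupp : ∀ y, y ∉ bl x ρ → f y = 0) (hlc : ∀ y, y ∈ bl x (ρ - N) → f y = f x)
    (hmean : ∫ y, f y ∂μ = 0) :
    ∫ ξ, G x (supIdx x ξ) * (f x - f ξ) ∂μ =
      (∑ i ∈ Finset.range N, (G x (ρ - (i + 1 : ℕ)) - G x (ρ - i)) *
        ((((p : ℝ) ^ (ρ - (i + 1 : ℕ)) : ℝ) : ℂ) * f x -
          (∫ y in bl x (ρ - (i + 1 : ℕ)), f y ∂μ))) +
      (G x ρ * (((p : ℝ) ^ ρ : ℝ) : ℂ) + ∫ η in (bl x ρ)ᶜ, G x (supIdx x η) ∂μ) * f x := by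
  classical
  set C : ℂ := ∫ η in (bl x ρ)ᶜ, G x (supIdx x η) ∂μ with hC
  set T : ℤ → ℂ := fun j => ∫ y in bl x j, (f y - f x) ∂μ with hT
  set c : ℕ → ℂ := fun i => G x (ρ - (i + 1 : ℕ)) - G x (ρ - i) with hc
  have hu : Continuous (fun y => f y - f x) := hf.sub continuous_const
  have h1 : HI μ (fun η => (-1) * ((G x ρ * (bl x ρ).indicator (fun y => f y - f x) η +
      ∑ i ∈ Finset.range N, (c i) *
        (bl x (ρ - (i + 1 : ℕ))).indicator (fun y => f y - f x) η) +
      (-f x) * ((bl x ρ)ᶜ).indicator (fun η => G x (supIdx x η)) η)) _ :=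
    ((((HI.ind (meas_bl x ρ) (integrableOn_bl μ hu x ρ)).mul (G x ρ)).add
      (HI.sum fun i => (HI.ind (meas_bl x (ρ - (i + 1 : ℕ)))
        (integrableOn_bl μ hu x (ρ - (i + 1 : ℕ)))).mul (c i))).add
      ((HI.ind (meas_bl x ρ).compl (integrable_inf μ hμ hGs x ρ)).mul (-f x))).mul (-1)
  rw [integral_congr_ae (g := fun η => (-1) * ((G x ρ *
      (bl x ρ).indicator (fun y => f y - f x) η +
      ∑ i ∈ Finset.range N, (c i) *
        (bl x (ρ - (i + 1 : ℕ))).indicator (fun y => f y - f x) η) +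
      (-f x) * ((bl x ρ)ᶜ).indicator (fun η => G x (supIdx x η)) η)), h1.2]
  · have hT0 : ∫ y in bl x ρ, (f y - f x) ∂μ = 0 - (((p : ℝ) ^ ρ : ℝ) : ℂ) * f x := by
      rw [int_sub_const μ hμ hf, setIntegral_eq_integral_of_forall_compl_eq_zero hsupp, hmean]
    rw [hT0]
    simp only [int_sub_const μ hμ hf]
    have : ∀ i ∈ Finset.range N, c i * ((((p : ℝ) ^ (ρ - (i + 1 : ℕ)) : ℝ) : ℂ) * f x -
          (∫ y in bl x (ρ - (i + 1 : ℕ)), f y ∂μ)) =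
        (-1) * (c i * ((∫ y in bl x (ρ - (i + 1 : ℕ)), f y ∂μ) -
          (((p : ℝ) ^ (ρ - (i + 1 : ℕ)) : ℝ) : ℂ) * f x)) := by
      intro i _
      ring
    rw [Finset.sum_congr rfl this, ← Finset.mul_sum]
    ring
  · filter_upwards [ae_ne' μ x] with η h2
    by_cases hη : η ∈ bl x ρ
    · rw [Set.indicator_of_mem hη, Set.indicator_of_notMem (by simpa using hη)]
      by_cases hs : ρ - N ≤ supIdx x η
      · rw [step_rep (G x) ρ N _ hs ((supIdx_le h2).2 hη)]
        have : ∀ i ∈ Finset.range N,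
            c i * (bl x (ρ - (i + 1 : ℕ))).indicator (fun y => f y - f x) η =
            (G x (ρ - (i + 1 : ℕ)) - G x (ρ - i)) *
              (if supIdx x η ≤ ρ - (i + 1 : ℕ) then 1 else 0) * (f η - f x) := by
          intro i _
          simp only [supIdx_le h2, hc]
          by_cases hb : η ∈ bl x (ρ - (i + 1 : ℕ)) <;>
          simp only [hb, Set.indicator_of_mem, Set.indicator_of_notMem, if_true, if_false,
            not_false_eq_true] <;> ring
        rw [Finset.sum_congr rfl this, ← Finset.sum_mul]
        ring
      · have hz : f η = f x := hlc η ((supIdx_le h2).1 (not_le.1 hs).le)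
        have : ∀ i ∈ Finset.range N,
            c i * (bl x (ρ - (i + 1 : ℕ))).indicator (fun y => f y - f x) η = 0 := by
          intro i _
          by_cases hb : η ∈ bl x (ρ - (i + 1 : ℕ))
          · rw [Set.indicator_of_mem hb, hz, sub_self, mul_zero]
          · rw [Set.indicator_of_notMem hb, mul_zero]
        rw [Finset.sum_congr rfl this, hz]
        simp
    · rw [Set.indicator_of_notMem hη, Set.indicator_of_mem (by simpa using hη), hsupp η hη]
      have : ∀ i ∈ Finset.range N,
          c i * (bl x (ρ - (i + 1 : ℕ))).indicator (fun y => f y - f x) η = 0 := by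
        intro i _
        rw [Set.indicator_of_notMem (fun hb => hη (bl_mono x (by omega) hb)), mul_zero]
      rw [Finset.sum_congr rfl this]
      simp
      ring

/-- Outside of the support of `f` the operator vanishes. -/
lemma op_out (F G : ℚ_[p] → ℤ → ℂ) {f : ℚ_[p] → ℂ} {x c : ℚ_[p]} {ρ : ℤ} (hx : x ∉ bl c ρ)
    (hsupp : ∀ y, y ∉ bl c ρ → f y = 0) (hmean : ∫ y, f y ∂μ = 0) :
    cascadeOp μ F G f x = 0 := by
  have hfx : f x = 0 := hsupp x hx
  have hcx : c ∉ bl x ρ := fun h => hx (mem_bl_comm.1 h)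
  have key : ∀ ξ, ξ ∈ bl c ρ → ξ ≠ x ∧ supIdx x ξ = supIdx x c := by
    intro ξ hξ
    have hne : ξ ≠ x := by rintro rfl; exact hx hξ
    have hcne : c ≠ x := by rintro rfl; exact hx (mem_bl_self _ _)
    have hξx : ξ ∉ bl x ρ := fun h => hx (bl_trans hξ (mem_bl_comm.1 h))
    have h1 := (supIdx_congr (mem_bl_self x ρ) hcx).2
    have h2 := (supIdx_congr (mem_bl_self x ρ) hξx).2
    refine ⟨hne, le_antisymm ?_ ?_⟩
    · rw [supIdx_le hne]
      exact bl_trans ((supIdx_le hcne).1 le_rfl) (bl_mono _ h1.le hξ)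
    · rw [supIdx_le hcne]
      exact bl_trans ((supIdx_le hne).1 le_rfl) (mem_bl_comm.1 (bl_mono _ h2.le hξ))
  unfold cascadeOp
  have h1 : ∀ ξ, ∫ η, F x (sup3Idx x ξ η) * (f ξ * (f η - f x)) ∂μ = 0 := by
    intro ξ
    by_cases hξ : ξ ∈ bl c ρ
    · have : ∫ η, F x (sup3Idx x ξ η) * (f ξ * (f η - f x)) ∂μ =
          ∫ η, (F x (supIdx x c) * f ξ) * f η ∂μ := by
        apply integral_congr_ae
        filter_upwards [ae_ne' μ ξ] with η h3
        by_cases hη : η ∈ bl c ρ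
        · rw [sup3_eq (key ξ hξ).1 (key η hη).1 h3, (key ξ hξ).2, (key η hη).2, max_self, hfx]
          ring
        · rw [hsupp η hη, hfx]
          ring
      rw [this, integral_const_mul, hmean, mul_zero]
    · simp [hsupp ξ hξ]
  have h2 : ∫ ξ, G x (supIdx x ξ) * (f x - f ξ) ∂μ = ∫ ξ, (-G x (supIdx x c)) * f ξ ∂μ := by
    congr 1
    ext ξ
    by_cases hξ : ξ ∈ bl c ρ
    · rw [(key ξ hξ).2, hfx]
      ring
    · rw [hsupp ξ hξ, hfx]
      ring
  simp only [h1, h2, integral_zero, integral_const_mul, hmean, mul_zero, add_zero]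

/-- The triangular system of linear ordinary differential equations: first component is the
partial average, the second one is the coefficient of the next linear equation. -/
noncomputable def sysSeq (d b c : ℕ → ℂ) (a : ℂ) : ℕ → (ℝ → ℂ) × (ℝ → ℂ)
  | 0 => (fun _ => 0, fun _ => a)
  | n + 1 =>
    (fun t => (sysSeq d b c a n).1 t + d n * Complex.exp (∫ s in (0 : ℝ)..t, (sysSeq d b c a n).2 s),
     fun t => (sysSeq d b c a n).2 t + (b n * ((sysSeq d b c a n).1 t +
      d n * Complex.exp (∫ s in (0 : ℝ)..t, (sysSeq d b c a n).2 s)) + c n))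

lemma sysSeq_fst_succ (d b c : ℕ → ℂ) (a : ℂ) (n : ℕ) (t : ℝ) :
    (sysSeq d b c a (n + 1)).1 t = (sysSeq d b c a n).1 t +
      d n * Complex.exp (∫ s in (0 : ℝ)..t, (sysSeq d b c a n).2 s) := rfl

lemma sysSeq_snd_succ (d b c : ℕ → ℂ) (a : ℂ) (n : ℕ) (t : ℝ) :
    (sysSeq d b c a (n + 1)).2 t = (sysSeq d b c a n).2 t +
      (b n * (sysSeq d b c a (n + 1)).1 t + c n) := rfl

lemma sysSeq_cont (d b c : ℕ → ℂ) (a : ℂ) (n : ℕ) :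
    Continuous (sysSeq d b c a n).1 ∧ Continuous (sysSeq d b c a n).2 := by
  induction n with
  | zero => exact ⟨continuous_const, continuous_const⟩
  | succ n ih =>
    have h1 : Continuous (sysSeq d b c a (n + 1)).1 := by
      have : Continuous (fun t : ℝ => ∫ s in (0 : ℝ)..t, (sysSeq d b c a n).2 s) :=
        intervalIntegral.continuous_primitive (fun _ _ => ih.2.intervalIntegrable _ _) 0
      exact ih.1.add (continuous_const.mul (Complex.continuous_exp.comp this))
    exact ⟨h1, ih.2.add ((continuous_const.mul h1).add continuous_const)⟩

lemma sysSeq_snd (d b c : ℕ → ℂ) (a : ℂ) (n : ℕ) (t : ℝ) :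
    (sysSeq d b c a n).2 t =
      a + ∑ i ∈ Finset.range n, (b i * (sysSeq d b c a (i + 1)).1 t + c i) := by
  induction n with
  | zero => simp [sysSeq]
  | succ n ih => rw [sysSeq_snd_succ, ih, Finset.sum_range_succ, add_assoc]

lemma abel_sum (A e : ℕ → ℂ) (a : ℂ) (N : ℕ) :
    ∑ n ∈ Finset.range N, (A (n + 1) - A n) * (a + ∑ i ∈ Finset.range n, e i) =
      a * (A N - A 0) + ∑ i ∈ Finset.range N, e i * (A N - A (i + 1)) := by
  induction N with
  | zero => simp
  | succ N ih =>
    rw [Finset.sum_range_succ, ih, Finset.sum_range_succ, sub_self, mul_zero, add_zero]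
    have : ∑ i ∈ Finset.range N, e i * (A (N + 1) - A (i + 1)) =
        ∑ i ∈ Finset.range N, e i * (A N - A (i + 1)) +
          (A (N + 1) - A N) * ∑ i ∈ Finset.range N, e i := by
      rw [Finset.mul_sum, ← Finset.sum_add_distrib]
      apply Finset.sum_congr rfl
      intro i _
      ring
    rw [this]
    ring

lemma sysSeq_deriv (d b c : ℕ → ℂ) (a : ℂ) (n : ℕ) (t : ℝ) :
    HasDerivAt (sysSeq d b c a n).1 (∑ k ∈ Finset.range n,
      ((sysSeq d b c a (k + 1)).1 t - (sysSeq d b c a k).1 t) * (sysSeq d b c a k).2 t) t := by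
  induction n with
  | zero => simpa [sysSeq] using hasDerivAt_const t (0 : ℂ)
  | succ n ih =>
    have hc := (sysSeq_cont d b c a n).2
    have h1 : HasDerivAt (fun t : ℝ => ∫ s in (0 : ℝ)..t, (sysSeq d b c a n).2 s)
        ((sysSeq d b c a n).2 t) t :=
      intervalIntegral.integral_hasDerivAt_right (hc.intervalIntegrable _ _)
        (hc.stronglyMeasurableAtFilter _ _) hc.continuousAt
    have h2 := ih.add (h1.cexp.const_mul (d n))
    rw [Finset.sum_range_succ]
    refine h2.congr_deriv ?_
    rw [sysSeq_fst_succ]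
    ring

lemma sysSeq_zero (d b c : ℕ → ℂ) (a : ℂ) (n : ℕ) :
    (sysSeq d b c a n).1 0 = ∑ k ∈ Finset.range n, d k := by
  induction n with
  | zero => simp [sysSeq]
  | succ n ih => rw [sysSeq_fst_succ, ih, Finset.sum_range_succ]; simp

lemma sysSeq_eq_zero (d b c : ℕ → ℂ) (a : ℂ) (n : ℕ) (hd : ∀ k, d k = 0) (t : ℝ) :
    (sysSeq d b c a n).1 t = 0 := by
  induction n with
  | zero => simp [sysSeq]
  | succ n ih => rw [sysSeq_fst_succ, ih, hd]; simp

lemma sysSeq_congr {d b c d' b' c' : ℕ → ℂ} {a a' : ℂ} (n : ℕ) (ha : a = a')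
    (hd : ∀ k < n, d k = d' k) (hb : ∀ k < n, b k = b' k) (hc : ∀ k < n, c k = c' k) :
    sysSeq d b c a n = sysSeq d' b' c' a' n := by
  induction n with
  | zero => simp [sysSeq, ha]
  | succ n ih =>
    have := ih (fun k hk => hd k (by omega)) (fun k hk => hb k (by omega))
      (fun k hk => hc k (by omega))
    simp only [sysSeq, this, hd n (by omega), hb n (by omega), hc n (by omega)]

lemma sysSeq_contDiff (d b c : ℕ → ℂ) (a : ℂ) (n : ℕ) :
    ContDiff ℝ 1 (sysSeq d b c a n).1 := by
  rw [contDiff_one_iff_deriv]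
  refine ⟨fun t => (sysSeq_deriv d b c a n t).differentiableAt, ?_⟩
  have : deriv (sysSeq d b c a n).1 = fun t => ∑ k ∈ Finset.range n,
      ((sysSeq d b c a (k + 1)).1 t - (sysSeq d b c a k).1 t) * (sysSeq d b c a k).2 t := by
    ext t
    exact (sysSeq_deriv d b c a n t).deriv
  rw [this]
  refine continuous_finsetSum _ fun k _ => ?_
  exact ((sysSeq_cont d b c a (k + 1)).1.sub (sysSeq_cont d b c a k).1).mul
    (sysSeq_cont d b c a k).2

end Helpers

/-- For summable ball kernels `F`, `G` and an initial condition
`v₀ ∈ D_0(ℚ_p)` there exists a solution `v` of the Cauchy problem for the quadratic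
cascade equation: (i) uniformly in `t ≥ 0`, `v(·,t)` is supported in a fixed ball `B₀`,
constant on every ball of radius `p^γ₀`, and has mean zero; (ii) `t ↦ v(x,t)` is `C¹`
on `[0,∞)`; (iii) `v(·,0) = v₀`; (iv) the quadratic cascade equation holds for `t > 0`. -/
theorem cascade_cauchy_existence {p : ℕ} [Fact p.Prime]
    [MeasurableSpace ℚ_[p]] [BorelSpace ℚ_[p]]
    (μ : Measure ℚ_[p]) [μ.IsAddHaarMeasure] (hμ : μ (Metric.closedBall 0 1) = 1)
    (F G : ℚ_[p] → ℤ → ℂ) (hF : IsBallKernel F) (hG : IsBallKernel G)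
    (hFs : KernelSummable F) (hGs : KernelSummable G)
    (v₀ : ℚ_[p] → ℂ)
    (hv₀supp : ∃ (c₀ : ℚ_[p]) (γ : ℤ), ∀ x, (p : ℝ) ^ γ < dist x c₀ → v₀ x = 0)
    (hv₀lc : ∃ γ : ℤ, ∀ x y, dist x y ≤ (p : ℝ) ^ γ → v₀ x = v₀ y)
    (hv₀mean : (∫ x, v₀ x ∂μ) = 0) :
    ∃ v : ℚ_[p] → ℝ → ℂ,
      (∃ (c₀ : ℚ_[p]) (γB γ₀ : ℤ), ∀ t : ℝ, 0 ≤ t →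
        (∀ x, (p : ℝ) ^ γB < dist x c₀ → v x t = 0) ∧
        (∀ x y, dist x y ≤ (p : ℝ) ^ γ₀ → v x t = v y t) ∧
        (∫ x, v x t ∂μ) = 0) ∧
      (∀ x, ContDiffOn ℝ 1 (fun t => v x t) (Set.Ici (0 : ℝ))) ∧
      (∀ x, v x 0 = v₀ x) ∧
      SatisfiesCascade μ F G v := by
  obtain ⟨c₀, γs, hs⟩ := hv₀supp
  obtain ⟨γ₀, hlc⟩ := hv₀lc
  obtain ⟨ρ, N, hρs, hN⟩ : ∃ (ρ : ℤ) (N : ℕ), γs ≤ ρ ∧ ρ - N = γ₀ :=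
    ⟨max γs γ₀, (max γs γ₀ - γ₀).toNat, le_max_left _ _, by
      have := le_max_right γs γ₀
      omega⟩
  have hv₀c : Continuous v₀ := cont_of_lc hlc
  have hsupp₀ : ∀ y, y ∉ bl c₀ ρ → v₀ y = 0 := by
    intro y hy
    apply hs
    rw [Metric.mem_closedBall, not_le] at hy
    exact lt_of_le_of_lt (pz_le.2 hρs) hy
  -- radii
  set q : ℕ → ℂ := fun n => (((p : ℝ) ^ (ρ - n) : ℝ) : ℂ) with hq
  have hq0 : ∀ n, q n ≠ 0 := fun n => Complex.ofReal_ne_zero.2 (pz_pos _).ne'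
  have hμq : ∀ (x : ℚ_[p]) (n : ℕ), (μ.real (bl x (ρ - n)) : ℂ) = q n := by
    intro x n
    rw [μr_bl μ hμ]
  -- averages of the initial condition
  set avg : ℕ → ℚ_[p] → ℂ := fun n x => (q n)⁻¹ * ∫ y in bl x (ρ - n), v₀ y ∂μ with havg
  set d : ℚ_[p] → ℕ → ℂ := fun x n => avg (n + 1) x - avg n x with hd
  set b : ℚ_[p] → ℕ → ℂ := fun x n =>
    (F x (ρ - (n + 1 : ℕ)) - F x (ρ - n)) * (q (n + 1) * q (n + 1)) with hb
  set c : ℚ_[p] → ℕ → ℂ := fun x n =>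
    -((G x (ρ - (n + 1 : ℕ)) - G x (ρ - n)) * q (n + 1)) with hc
  set a : ℚ_[p] → ℂ := fun x =>
    -(G x ρ * (((p : ℝ) ^ ρ : ℝ) : ℂ) + ∫ η in (bl x ρ)ᶜ, G x (supIdx x η) ∂μ) with ha
  set S : ℚ_[p] → ℕ → (ℝ → ℂ) × (ℝ → ℂ) := fun x => sysSeq (d x) (b x) (c x) (a x) with hS
  -- local constancy of the coefficients
  have havg_c : ∀ (n : ℕ) (x y : ℚ_[p]), y ∈ bl x (ρ - n) → avg n y = avg n x := by
    intro n x y h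
    simp only [havg]
    rw [bl_eq h]
  have hdc : ∀ (n : ℕ) (x y : ℚ_[p]), y ∈ bl x (ρ - (n + 1 : ℕ)) → d y n = d x n := by
    intro n x y h
    simp only [hd]
    rw [havg_c (n + 1) x y h, havg_c n x y (bl_mono x (by omega) h)]
  have hFc : ∀ (K : ℚ_[p] → ℤ → ℂ), IsBallKernel K → ∀ (j : ℤ) (x y : ℚ_[p]), y ∈ bl x j →
      K y j = K x j := fun K hK j x y h => hK y x j (by rwa [Metric.mem_closedBall] at h)
  have hac : ∀ (x y : ℚ_[p]), y ∈ bl x ρ → a y = a x := by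
    intro x y h
    simp only [ha]
    rw [hFc G hG ρ x y h, bl_eq h]
    congr 2
    apply setIntegral_congr_fun (meas_bl x ρ).compl
    intro η hη
    have h1 := supIdx_congr h hη
    simp only
    rw [← h1.1]
    exact hFc G hG _ x y (bl_mono x h1.2.le h)
  have hSc : ∀ (n : ℕ) (x y : ℚ_[p]), y ∈ bl x (ρ - n) → S y n = S x n := by
    intro n x y h
    have hm : ∀ j : ℤ, ρ - n ≤ j → y ∈ bl x j := fun j hj => bl_mono x hj h
    apply sysSeq_congr n (hac x y (hm _ (by omega)))
    · intro k hk
      exact hdc k x y (hm _ (by omega))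
    · intro k hk
      simp only [hb]
      rw [hFc F hF _ x y (hm _ (by omega)), hFc F hF _ x y (hm (ρ - k) (by omega))]
    · intro k hk
      simp only [hc]
      rw [hFc G hG _ x y (hm _ (by omega)), hFc G hG _ x y (hm (ρ - k) (by omega))]
  have hAcont : ∀ (n : ℕ) (t : ℝ), Continuous (fun x => (S x n).1 t) := by
    intro n t
    apply cont_of_lc (j := ρ - n)
    intro x y h
    rw [hSc n x y (mem_bl.2 h)]
  have havg_cont : ∀ n, Continuous (avg n) := fun n =>
    cont_of_lc (j := ρ - n) fun x y h => (havg_c n x y (mem_bl.2 h)).symm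
  have hd_cont : ∀ n, Continuous (fun x => d x n) := fun n =>
    (havg_cont (n + 1)).sub (havg_cont n)
  -- the averages have the right integrals
  have havg_int : ∀ (m n : ℕ) (x : ℚ_[p]), n ≤ m →
      ∫ y in bl x (ρ - n), avg m y ∂μ = ∫ y in bl x (ρ - n), v₀ y ∂μ := by
    intro m n x h
    simp only [havg]
    rw [integral_const_mul, tower μ hv₀c x (by omega : ρ - (m : ℤ) ≤ ρ - n), hμq,
      inv_mul_cancel_left₀ (hq0 m)]
  have hd_int : ∀ (n : ℕ) (x : ℚ_[p]), ∫ y in bl x (ρ - n), d y n ∂μ = 0 := by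
    intro n x
    simp only [hd]
    rw [integral_sub (integrableOn_bl μ (havg_cont (n + 1)) _ _)
      (integrableOn_bl μ (havg_cont n) _ _), havg_int _ _ _ (Nat.le_succ n),
      havg_int _ _ _ le_rfl, sub_self]
  have hA_int : ∀ (t : ℝ) (n m : ℕ) (x : ℚ_[p]), n ≤ m →
      ∫ y in bl x (ρ - n), (S y m).1 t ∂μ = q n * (S x n).1 t := by
    intro t n m x hnm
    induction m, hnm using Nat.le_induction with
    | base =>
      rw [setIntegral_congr_fun (g := fun _ => (S x n).1 t) (meas_bl _ _)]
      · rw [setIntegral_const, Complex.real_smul, hμq]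
      · intro y hy
        simp only
        rw [hSc n x y hy]
    | succ m hm ih =>
      set E : ℚ_[p] → ℂ := fun y => Complex.exp (∫ s in (0 : ℝ)..t, (S y m).2 s) with hE
      have hEc : ∀ x y, y ∈ bl x (ρ - m) → E y = E x := by
        intro x y h
        simp only [hE]
        rw [hSc m x y h]
      have hEcont : Continuous E :=
        cont_of_lc (j := ρ - m) fun x y h => (hEc x y (mem_bl.2 h)).symm
      have hg : Continuous (fun y => d y m * E y) := (hd_cont m).mul hEcont
      have e : ∀ y, (S y (m + 1)).1 t = (S y m).1 t + d y m * E y := fun y => rfl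
      simp_rw [e]
      rw [integral_add (integrableOn_bl μ (hAcont m t) _ _) (integrableOn_bl μ hg _ _), ih]
      have h0 : ∀ y, ∫ z in bl y (ρ - m), d z m * E z ∂μ = 0 := by
        intro y
        rw [setIntegral_congr_fun (g := fun z => d z m * E y) (meas_bl _ _)]
        · rw [integral_mul_const, hd_int, zero_mul]
        · intro z hz
          simp only
          rw [hEc y z hz]
      have h1 := tower μ hg x (by omega : ρ - (m : ℤ) ≤ ρ - n)
      simp_rw [h0] at h1
      rw [integral_zero, hμq] at h1
      rw [(mul_eq_zero.1 h1.symm).resolve_left (hq0 m), add_zero]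
  have hAsupp : ∀ (n : ℕ) (t : ℝ) (x : ℚ_[p]), x ∉ bl c₀ ρ → (S x n).1 t = 0 := by
    intro n t x hx
    apply sysSeq_eq_zero
    have h0 : ∀ k : ℕ, avg k x = 0 := by
      intro k
      simp only [havg]
      rw [setIntegral_congr_fun (g := fun _ => (0 : ℂ)) (meas_bl _ _)]
      · simp
      · intro y hy
        apply hsupp₀
        intro hyc
        exact hx (bl_trans hyc (mem_bl_comm.1 (bl_mono x (by omega) hy)))
    intro k
    simp [hd, h0]
  have hmean : ∀ (n : ℕ) (t : ℝ), ∫ x, (S x n).1 t ∂μ = 0 := by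
    intro n t
    rw [← setIntegral_eq_integral_of_forall_compl_eq_zero (hAsupp n t)]
    have := hA_int t 0 n c₀ (Nat.zero_le _)
    simp only [Nat.cast_zero, sub_zero] at this
    rw [this]
    simp [hS, sysSeq]
  refine ⟨fun x t => (S x N).1 t, ⟨c₀, ρ, γ₀, fun t _ => ⟨?_, ?_, hmean N t⟩⟩, ?_, ?_, ?_⟩
  · intro x hx
    apply hAsupp
    rw [Metric.mem_closedBall, not_le]
    exact hx
  · intro x y h
    rw [← hN] at h
    simp only
    rw [hSc N x y (mem_bl.2 h)]
  · intro x
    exact (sysSeq_contDiff _ _ _ _ N).contDiffOn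
  · intro x
    simp only [hS]
    rw [sysSeq_zero]
    simp only [hd]
    rw [Finset.sum_range_sub (fun n => avg n x)]
    have h0 : avg 0 x = 0 := by
      simp only [havg, Nat.cast_zero, sub_zero]
      by_cases hx : x ∈ bl c₀ ρ
      · rw [bl_eq hx, setIntegral_eq_integral_of_forall_compl_eq_zero hsupp₀, hv₀mean, mul_zero]
      · rw [setIntegral_congr_fun (g := fun _ => (0 : ℂ)) (meas_bl _ _)]
        · simp
        · intro y hy
          apply hsupp₀
          intro hyc
          exact hx (bl_trans hyc (mem_bl_comm.1 hy))
    have h1 : avg N x = v₀ x := by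
      simp only [havg]
      rw [setIntegral_congr_fun (g := fun _ => v₀ x) (meas_bl _ _)]
      · rw [setIntegral_const, Complex.real_smul, hμq, inv_mul_cancel_left₀ (hq0 N)]
      · intro y hy
        exact (hlc x y (by rw [← hN]; exact mem_bl.1 hy)).symm
    rw [h0, h1, sub_zero]
  · intro x t _
    refine (sysSeq_deriv (d x) (b x) (c x) (a x) N t).congr_deriv ?_
    by_cases hx : x ∈ bl c₀ ρ
    · have hsx : ∀ y, y ∉ bl x ρ → (S y N).1 t = 0 := by
        intro y hy
        rw [bl_eq hx] at hy
        exact hAsupp N t y hy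
      have hlx : ∀ y, y ∈ bl x (ρ - N) → (S y N).1 t = (S x N).1 t := by
        intro y hy
        rw [hSc N x y hy]
      unfold cascadeOp
      rw [op_F μ hμ hFs (hAcont N t) x ρ N hsx hlx (hmean N t),
        op_G μ hμ hGs (hAcont N t) x ρ N hsx hlx (hmean N t)]
      simp_rw [sysSeq_snd]
      rw [abel_sum (fun n => (sysSeq (d x) (b x) (c x) (a x) n).1 t)]
      change a x * ((S x N).1 t - (S x 0).1 t) + ∑ i ∈ Finset.range N,
        (b x i * (S x (i + 1)).1 t + c x i) * ((S x N).1 t - (S x (i + 1)).1 t) = _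
      have hz : (S x 0).1 t = 0 := rfl
      rw [hz]
      have e1 : ∀ i ∈ Finset.range N, ∫ y in bl x (ρ - (i + 1 : ℕ)), (S y N).1 t ∂μ =
          q (i + 1) * (S x (i + 1)).1 t := by
        intro i hi
        exact hA_int t (i + 1) N x (Finset.mem_range.1 hi)
      have e2 : ∑ i ∈ Finset.range N,
          (b x i * (S x (i + 1)).1 t + c x i) * ((S x N).1 t - (S x (i + 1)).1 t) =
          -(∑ i ∈ Finset.range N, (F x (ρ - (i + 1 : ℕ)) - F x (ρ - i)) *
            (∫ y in bl x (ρ - (i + 1 : ℕ)), (S y N).1 t ∂μ) *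
            ((∫ y in bl x (ρ - (i + 1 : ℕ)), (S y N).1 t ∂μ) -
              (((p : ℝ) ^ (ρ - (i + 1 : ℕ)) : ℝ) : ℂ) * (S x N).1 t)) -
          ∑ i ∈ Finset.range N, (G x (ρ - (i + 1 : ℕ)) - G x (ρ - i)) *
            ((((p : ℝ) ^ (ρ - (i + 1 : ℕ)) : ℝ) : ℂ) * (S x N).1 t -
              (∫ y in bl x (ρ - (i + 1 : ℕ)), (S y N).1 t ∂μ)) := by
        rw [← Finset.sum_neg_distrib, ← Finset.sum_sub_distrib]
        apply Finset.sum_congr rfl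
        intro i hi
        rw [e1 i hi]
        simp only [hb, hc, hq]
        ring
      rw [e2]
      simp only [ha]
      ring
    · rw [op_out μ F G hx (hAsupp N t) (hmean N t), neg_zero]
      apply Finset.sum_eq_zero
      intro k _
      have h1 := hAsupp (k + 1) t x hx
      have h2 := hAsupp k t x hx
      simp only [hS] at h1 h2
      rw [h1, h2, sub_self, zero_mul]
end

section
/- Let F be a summable ball kernel, let φ be an ultrametric wavelet with ball I and ψ an ultrametric wavelet with ball J, and suppose I = J. Then 𝓘[φ, ψ](x) = 0 for every x ∈ ℚ_p. In particular, 𝓘[ψ, ψ](x) = 0 for every ultrametric wavelet ψ and every x. -/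
open MeasureTheory

/-- The nonlinear interaction integral
`𝓘[φ,ψ](x) = ∫∫ F(sup(x,ξ,η)) φ(ξ)(ψ(η) - ψ(x)) dμ(ξ) dμ(η)`. -/
noncomputable def IIntegral {p : ℕ} [Fact p.Prime] [MeasurableSpace ℚ_[p]]
    (μ : Measure ℚ_[p]) (F : ℚ_[p] → ℤ → ℂ) (φ ψ : ℚ_[p] → ℂ) (x : ℚ_[p]) : ℂ :=
  ∫ ξ, ∫ η, F x (sup3Idx x ξ η) * (φ ξ * (ψ η - ψ x)) ∂μ ∂μ

theorem supIdx_le_aux {p : ℕ} [Fact p.Prime] (x y z w : ℚ_[p]) (hxy : x ≠ y) (hzw : z ≠ w)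
    (h : dist x y ≤ dist z w) : supIdx x y ≤ supIdx z w := by
  have hp : (1 : ℝ) < p := by exact_mod_cast (Fact.out : p.Prime).one_lt
  rw [dist_eq_norm, dist_eq_norm, Padic.norm_eq_zpow_neg_valuation (sub_ne_zero.2 hxy),
    Padic.norm_eq_zpow_neg_valuation (sub_ne_zero.2 hzw)] at h
  exact (zpow_le_zpow_iff_right₀ hp).1 h

theorem dist_ge_aux {p : ℕ} [Fact p.Prime] (x y : ℚ_[p]) (γ : ℤ)
    (h : (p : ℝ) ^ (γ - 1) < dist x y) : (p : ℝ) ^ γ ≤ dist x y := by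
  have hp : (1 : ℝ) < p := by exact_mod_cast (Fact.out : p.Prime).one_lt
  have hxy : x ≠ y := by
    rintro rfl
    rw [dist_self] at h
    exact absurd h (not_lt.2 (by positivity))
  rw [dist_eq_norm, Padic.norm_eq_zpow_neg_valuation (sub_ne_zero.2 hxy)] at h ⊢
  have := (zpow_lt_zpow_iff_right₀ hp).1 h
  exact (zpow_le_zpow_iff_right₀ hp).2 (by omega)

theorem IIntegral_zero_aux {p : ℕ} [Fact p.Prime]
    [MeasurableSpace ℚ_[p]] [BorelSpace ℚ_[p]]
    (μ : Measure ℚ_[p]) [μ.IsAddHaarMeasure]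
    (F : ℚ_[p] → ℤ → ℂ) (φ ψ : ℚ_[p] → ℂ) (c : ℚ_[p]) (γ : ℤ)
    (hφ : ∀ x, (p : ℝ) ^ γ < dist x c → φ x = 0) (hφ0 : ∫ x, φ x ∂μ = 0)
    (hψ : IsWavelet μ ψ c γ) (x : ℚ_[p]) : IIntegral μ F φ ψ x = 0 := by
  have hne : ∀ a : ℚ_[p], ∀ᵐ y ∂μ, y ≠ a := fun a => by
    rw [ae_iff]; simp
  have um : ∀ a b d : ℚ_[p], dist a d ≤ max (dist a b) (dist b d) := fun a b d =>
    IsUltrametricDist.dist_triangle_max a b d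
  have key : ∀ᵐ ξ ∂μ, (∫ η, F x (sup3Idx x ξ η) * (φ ξ * (ψ η - ψ x)) ∂μ) =
      φ ξ * ∫ η, F x (supIdx x η) * (ψ η - ψ x) ∂μ := by
    filter_upwards [hne x] with ξ hξ
    rw [← integral_const_mul]
    refine integral_congr_ae ?_
    filter_upwards [hne ξ] with η hη
    by_cases h0 : φ ξ = 0
    · simp [h0]
    by_cases h1 : ψ η = ψ x
    · simp [h1]
    have hξc : dist ξ c ≤ (p : ℝ) ^ γ := not_lt.1 fun h => h0 (hφ ξ h)
    have hd : (p : ℝ) ^ γ ≤ dist x η := dist_ge_aux _ _ _ (not_le.1 fun h => h1 (hψ.2.1 _ _ h).symm)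
    have hxη : x ≠ η := by rintro rfl; exact h1 rfl
    have hor : dist x c ≤ (p : ℝ) ^ γ ∨ dist η c ≤ (p : ℝ) ^ γ := by
      by_contra! h
      exact h1 ((hψ.1 _ h.2).trans (hψ.1 _ h.1).symm)
    have hboth : dist x ξ ≤ dist x η ∧ dist ξ η ≤ dist x η := by
      rcases hor with h | h
      · have h2 : dist x ξ ≤ dist x η :=
          (um x c ξ).trans (max_le (h.trans hd) (by rw [dist_comm]; exact hξc.trans hd))
        exact ⟨h2, (um ξ x η).trans (max_le (by rwa [dist_comm]) le_rfl)⟩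
      · have h2 : dist ξ η ≤ dist x η :=
          (um ξ c η).trans (max_le (hξc.trans hd) (by rw [dist_comm c]; exact h.trans hd))
        exact ⟨(um x η ξ).trans (max_le le_rfl (by rwa [dist_comm η])), h2⟩
    have hs : sup3Idx x ξ η = supIdx x η := by
      unfold sup3Idx
      have a1 := supIdx_le_aux x ξ x η hξ.symm hxη hboth.1
      have a2 := supIdx_le_aux ξ η x η hη.symm hxη hboth.2
      omega
    rw [hs]; ring
  unfold IIntegral
  rw [integral_congr_ae key, integral_mul_const, hφ0, zero_mul]

/-- If the balls of `φ` and `ψ` coincide then `𝓘[φ,ψ](x) = 0` for every `x`;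
in particular `𝓘[ψ,ψ](x) = 0` for every ultrametric wavelet `ψ` and every `x`. -/
theorem I_integral_equal_balls {p : ℕ} [Fact p.Prime]
    [MeasurableSpace ℚ_[p]] [BorelSpace ℚ_[p]]
    (μ : Measure ℚ_[p]) [μ.IsAddHaarMeasure] (hμ : μ (Metric.closedBall 0 1) = 1)
    (F : ℚ_[p] → ℤ → ℂ) (hF : IsBallKernel F) (hFs : KernelSummable F)
    (φ ψ : ℚ_[p] → ℂ) (cI cJ : ℚ_[p]) (γI γJ : ℤ)
    (hφ : IsWavelet μ φ cI γI) (hψ : IsWavelet μ ψ cJ γJ)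
    (heq : Metric.closedBall cI ((p : ℝ) ^ γI) = Metric.closedBall cJ ((p : ℝ) ^ γJ)) :
    (∀ x : ℚ_[p], IIntegral μ F φ ψ x = 0) ∧
      (∀ x : ℚ_[p], IIntegral μ F ψ ψ x = 0) := by
  refine ⟨fun x => IIntegral_zero_aux μ F φ ψ cJ γJ (fun y hy => hφ.1 y ?_) hφ.2.2.1 hψ x,
    fun x => IIntegral_zero_aux μ F ψ ψ cJ γJ hψ.1 hψ.2.2.1 hψ x⟩
  by_contra h
  have hm : y ∈ Metric.closedBall cI ((p : ℝ) ^ γI) := not_lt.1 h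
  rw [heq] at hm
  exact absurd hy (not_lt.2 hm)
end

section
/- Let F be a summable ball kernel, let φ be an ultrametric wavelet with ball I = B(c, p^{γ_I}) and ψ an ultrametric wavelet with ball J = B(c, p^{γ_J}), where J is a strict subset of I (so γ_J < γ_I and one may take the same center c ∈ J for both). Then for every x ∈ ℚ_p, 𝓘[φ, ψ](x) = ψ(x) φ(x) Φ_{I,J}. -/
open MeasureTheory

section Aux

variable {p : ℕ} [hp : Fact p.Prime]

theorem aux_p_one_lt : (1 : ℝ) < p := by exact_mod_cast hp.out.one_lt

theorem aux_p_pos : (0 : ℝ) < p := lt_trans one_pos aux_p_one_lt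

theorem aux_dist_eq {x y : ℚ_[p]} (h : x ≠ y) : dist x y = (p : ℝ) ^ supIdx x y := by
  rw [dist_eq_norm, Padic.norm_eq_zpow_neg_valuation (sub_ne_zero.2 h)]; rfl

theorem aux_idx_le {x y : ℚ_[p]} (h : x ≠ y) (m : ℤ) :
    supIdx x y ≤ m ↔ dist y x ≤ (p : ℝ) ^ m := by
  rw [dist_comm, aux_dist_eq h, zpow_le_zpow_iff_right₀ aux_p_one_lt]

theorem aux_ultra (x y z : ℚ_[p]) : dist x z ≤ max (dist x y) (dist y z) :=
  dist_triangle_max x y z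

theorem aux_sup3 {x ξ η : ℚ_[p]} (h1 : x ≠ ξ) (h2 : x ≠ η) (h3 : ξ ≠ η) :
    sup3Idx x ξ η = max (supIdx x ξ) (supIdx x η) := by
  unfold sup3Idx
  have : supIdx ξ η ≤ max (supIdx x ξ) (supIdx x η) := by
    rw [aux_idx_le h3]
    refine (aux_ultra η x ξ).trans (max_le ?_ ?_)
    · exact (aux_idx_le h2 _).1 (le_max_right _ _)
    · rw [dist_comm]; exact (aux_idx_le h1 _).1 (le_max_left _ _)
  omega

variable [MeasurableSpace ℚ_[p]] [BorelSpace ℚ_[p]] (μ : Measure ℚ_[p]) [μ.IsAddHaarMeasure]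

theorem aux_real_ball (x : ℚ_[p]) (r : ℝ) :
    μ.real (Metric.closedBall x r) = μ.real (Metric.closedBall 0 r) := by
  have : (fun y => x + y) ⁻¹' Metric.closedBall x r = Metric.closedBall 0 r := by
    ext y; simp [dist_eq_norm]
  rw [measureReal_def, measureReal_def, ← this, measure_preimage_add]

theorem aux_fin (x : ℚ_[p]) (r : ℝ) : μ (Metric.closedBall x r) ≠ ⊤ :=
  (isCompact_closedBall x r).measure_lt_top.ne

theorem aux_step (m : ℤ) : μ.real (Metric.closedBall (0 : ℚ_[p]) ((p : ℝ) ^ (m + 1))) =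
    p * μ.real (Metric.closedBall (0 : ℚ_[p]) ((p : ℝ) ^ m)) := by
  have hp0 : (p : ℚ_[p]) ≠ 0 := by exact_mod_cast hp.out.ne_zero
  have hp0' : (p : ℝ) ≠ 0 := aux_p_pos.ne'
  set u : ℚ_[p] := (p : ℚ_[p]) ^ (-(m + 1)) with hu
  have hun : ‖u‖ = (p : ℝ) ^ (m + 1) := by
    rw [hu, Padic.norm_p_zpow, neg_neg]
  have hu0 : u ≠ 0 := zpow_ne_zero _ hp0
  have hmul : (p : ℝ) ^ m = (p : ℝ) ^ (m + 1) * (p : ℝ)⁻¹ := by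
    rw [zpow_add_one₀ hp0']; field_simp
  have hpos : (0 : ℝ) < (p : ℝ) ^ (m + 1) := zpow_pos aux_p_pos _
  have hcov : Metric.closedBall (0 : ℚ_[p]) ((p : ℝ) ^ (m + 1)) =
      ⋃ i ∈ Finset.range p, Metric.closedBall ((i : ℚ_[p]) * u) ((p : ℝ) ^ m) := by
    ext y
    simp only [Set.mem_iUnion, Metric.mem_closedBall, Finset.mem_range, dist_zero_right,
      exists_prop]
    constructor
    · intro hy
      have hz : ‖y / u‖ ≤ 1 := by
        rw [norm_div, hun]; exact (div_le_one hpos).2 hy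
      obtain ⟨z, hzz⟩ : ∃ z : ℤ_[p], (z : ℚ_[p]) = y / u := ⟨⟨y / u, hz⟩, rfl⟩
      obtain ⟨n, hn, hn'⟩ := PadicInt.exists_mem_range (p := p) z
      refine ⟨n, hn, ?_⟩
      rw [PadicInt.maximalIdeal_eq_span_p, Ideal.mem_span_singleton,
        ← pow_one (p : ℤ_[p]), ← Ideal.mem_span_singleton,
        ← PadicInt.norm_le_pow_iff_mem_span_pow] at hn'
      have h2 : ‖y / u - n‖ ≤ (p : ℝ)⁻¹ := by
        rw [Nat.cast_one, zpow_neg_one, PadicInt.norm_def, PadicInt.coe_sub,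
          PadicInt.coe_natCast, hzz] at hn'
        exact hn'
      have : y - n * u = u * (y / u - n) := by field_simp
      rw [dist_eq_norm, this, norm_mul, hun, hmul]
      gcongr
    · rintro ⟨i, hi, hy⟩
      have h1 : ‖(i : ℚ_[p]) * u‖ ≤ (p : ℝ) ^ (m + 1) := by
        rw [norm_mul, hun]
        have : ‖(i : ℚ_[p])‖ ≤ 1 := by exact_mod_cast Padic.norm_int_le_one (p := p) (i : ℤ)
        nlinarith
      have h2 := aux_ultra y ((i : ℚ_[p]) * u) 0
      rw [dist_zero_right, dist_zero_right] at h2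
      refine h2.trans (max_le (hy.trans ?_) h1)
      exact zpow_le_zpow_right₀ aux_p_one_lt.le (by omega)
  have hdis : Set.PairwiseDisjoint (↑(Finset.range p))
      (fun i : ℕ => Metric.closedBall ((i : ℚ_[p]) * u) ((p : ℝ) ^ m)) := by
    intro i hi j hj hij
    rw [Function.onFun, Set.disjoint_left]
    intro y hy hy'
    simp only [Finset.coe_range, Set.mem_Iio] at hi hj
    rw [Metric.mem_closedBall] at hy hy'
    have h2 := aux_ultra ((i : ℚ_[p]) * u) y ((j : ℚ_[p]) * u)
    rw [dist_comm _ y] at h2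
    have h3 := h2.trans (max_le hy hy')
    rw [dist_eq_norm, ← sub_mul, norm_mul, hun] at h3
    have h4 : ‖(((i : ℤ) - (j : ℤ) : ℤ) : ℚ_[p])‖ = 1 := by
      by_contra hne
      have hlt := lt_of_le_of_ne (Padic.norm_int_le_one (p := p) ((i : ℤ) - (j : ℤ))) hne
      rw [Padic.norm_intCast_lt_one_iff] at hlt
      have := Int.eq_zero_of_abs_lt_dvd hlt (by rw [abs_lt]; omega)
      omega
    push_cast at h4
    rw [h4, one_mul] at h3
    exact absurd h3 (not_le.2 (zpow_lt_zpow_right₀ aux_p_one_lt (by omega)))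
  rw [hcov, measureReal_biUnion_finset hdis (fun _ _ => Metric.isClosed_closedBall.measurableSet)
    (fun i _ => aux_fin μ _ _)]
  simp only [aux_real_ball μ (_ * u)]
  simp

theorem aux_vol (hμ : μ (Metric.closedBall 0 1) = 1) (x : ℚ_[p]) (m : ℤ) :
    μ.real (Metric.closedBall x ((p : ℝ) ^ m)) = (p : ℝ) ^ m := by
  have hp0' : (p : ℝ) ≠ 0 := aux_p_pos.ne'
  rw [aux_real_ball]
  induction m using Int.induction_on with
  | zero => simp [measureReal_def, hμ]
  | succ i ih => rw [aux_step, ih, zpow_add_one₀ hp0', mul_comm]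
  | pred i ih =>
    have := aux_step (p := p) μ (-(i : ℤ) - 1)
    rw [sub_add_cancel, ih] at this
    have h2 : (p : ℝ) ^ (-(i : ℤ)) = p * (p : ℝ) ^ (-(i : ℤ) - 1) := by
      rw [mul_comm, ← zpow_add_one₀ hp0', sub_add_cancel]
    rw [h2] at this
    exact (mul_left_cancel₀ hp0' this).symm

theorem aux_cont {ψ : ℚ_[p] → ℂ} {c : ℚ_[p]} {γ : ℤ} (h : IsWavelet μ ψ c γ) :
    Continuous ψ := by
  rw [continuous_iff_continuousAt]
  intro x
  have : ψ =ᶠ[nhds x] fun _ => ψ x := by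
    filter_upwards [Metric.closedBall_mem_nhds x (zpow_pos (aux_p_pos (p := p)) (γ - 1))] with y hy
    exact h.2.1 y x hy
  exact (continuousAt_const).congr this.symm

theorem aux_int {ψ : ℚ_[p] → ℂ} {c : ℚ_[p]} {γ : ℤ} (h : IsWavelet μ ψ c γ) :
    Integrable ψ μ := by
  refine (aux_cont μ h).integrable_of_hasCompactSupport ?_
  refine HasCompactSupport.intro (isCompact_closedBall c ((p : ℝ) ^ γ)) ?_
  intro x hx
  exact h.1 x (by simpa using hx)

theorem aux_ne (x : ℚ_[p]) : ∀ᵐ y ∂μ, x ≠ y := by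
  have : μ {x} = 0 := measure_singleton x
  filter_upwards [compl_mem_ae_iff.2 this] with y hy h
  exact hy h.symm

theorem aux_phi (f : ℤ → ℂ) (a b : ℤ) (h : a < b) :
    ∑ m ∈ Finset.Ico a b, (f m - f (m + 1)) * (-(((p : ℝ) ^ (2 * m) : ℝ) : ℂ)) =
    (((p : ℝ) ^ (2 * (b - 1)) : ℝ) : ℂ) * f b - (((p : ℝ) ^ (2 * a) : ℝ) : ℂ) * f a -
    ∑ γ ∈ Finset.Ioo a b, (((p : ℝ) ^ (2 * γ) - (p : ℝ) ^ (2 * γ - 2) : ℝ) : ℂ) * f γ := by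
  induction b, (Int.add_one_le_iff.2 h) using Int.leInduction with
  | base =>
    have h1 : Finset.Ico a (a + 1) = {a} := by ext; simp; omega
    have h2 : Finset.Ioo a (a + 1) = ∅ := by ext; simp
    rw [h1, h2]; simp; ring
  | succ n hn ih =>
    have h1 : Finset.Ico a (n + 1) = insert n (Finset.Ico a n) := by ext; simp; omega
    have h2 : Finset.Ioo a (n + 1) = insert n (Finset.Ioo a n) := by ext; simp; omega
    rw [h1, h2, Finset.sum_insert (by simp), Finset.sum_insert (by simp), ih (by omega)]
    have e1 : 2 * (n + 1 - 1) = 2 * n := by ring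
    have e2 : 2 * (n - 1) = 2 * n - 2 := by ring
    rw [e1, e2]; push_cast; ring

theorem aux_tele (f : ℤ → ℂ) (M b : ℤ) (h : M ≤ b) :
    ∑ m ∈ Finset.Ico M b, (f m - f (m + 1)) = f M - f b := by
  induction b, h using Int.leInduction with
  | base => simp
  | succ n hn ih =>
    have h1 : Finset.Ico M (n + 1) = insert n (Finset.Ico M n) := by ext; simp; omega
    rw [h1, Finset.sum_insert (by simp), ih]; ring

theorem aux_Gint (hμ : μ (Metric.closedBall 0 1) = 1)
    {F : ℚ_[p] → ℤ → ℂ} (hFs : KernelSummable F) {ψ : ℚ_[p] → ℂ} {c : ℚ_[p]} {γI γJ : ℤ}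
    (hγ : γJ < γI) (hψ : IsWavelet μ ψ c γJ) (x : ℚ_[p]) (hx : dist x c ≤ (p : ℝ) ^ γJ) :
    Integrable (fun η => F x (max γI (supIdx x η)) * (ψ η - ψ x)) μ := by
  set G := fun η => F x (max γI (supIdx x η)) * (ψ η - ψ x) with hG
  set S : ℕ → Set ℚ_[p] := fun n => Metric.closedBall x ((p : ℝ) ^ (γI + 1 + (n : ℤ))) \
    Metric.closedBall x ((p : ℝ) ^ (γI + (n : ℤ))) with hS
  have hSm : ∀ n, MeasurableSet (S n) := fun n =>
    Metric.isClosed_closedBall.measurableSet.diff Metric.isClosed_closedBall.measurableSet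
  have hSfin : ∀ n, μ (S n) ≠ ⊤ := fun n =>
    ne_top_of_le_ne_top (aux_fin μ x _) (measure_mono Set.sdiff_subset)
  have hSv : ∀ n, μ.real (S n) = (p : ℝ) ^ (γI + 1 + (n : ℤ)) - (p : ℝ) ^ (γI + (n : ℤ)) := by
    intro n
    rw [hS, measureReal_sdiff (Metric.closedBall_subset_closedBall
      (zpow_le_zpow_right₀ aux_p_one_lt.le (by omega))) Metric.isClosed_closedBall.measurableSet
      (aux_fin μ x _), aux_vol μ hμ, aux_vol μ hμ]
  have hSG : ∀ n, ∀ η ∈ S n, G η = F x (γI + 1 + n) * (-ψ x) := by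
    intro n η hη
    have hne : x ≠ η := by
      rintro rfl
      exact hη.2 (Metric.mem_closedBall_self (zpow_pos aux_p_pos _).le)
    have h1 : supIdx x η = γI + 1 + n := by
      have a1 := (aux_idx_le hne _).2 hη.1
      have a2 := mt (aux_idx_le hne _).1 hη.2
      omega
    have h2 : ψ η = 0 := by
      apply hψ.1
      by_contra hcon
      have := (aux_ultra η c x).trans (max_le (not_lt.1 hcon) (dist_comm x c ▸ hx))
      have := (aux_idx_le hne _).2 this
      omega
    simp only [hG, h1, h2, zero_sub]
    rw [max_eq_right (by omega)]
  have hball : IntegrableOn G (Metric.closedBall x ((p : ℝ) ^ γI)) μ := by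
    have h0 : IntegrableOn (fun η => F x γI * (ψ η - ψ x))
        (Metric.closedBall x ((p : ℝ) ^ γI)) μ :=
      ((aux_int μ hψ).integrableOn.sub (integrableOn_const (aux_fin μ x _))).const_mul _
    refine h0.congr ?_
    filter_upwards [ae_restrict_of_ae (aux_ne μ x),
      ae_restrict_mem Metric.isClosed_closedBall.measurableSet] with η hne hη
    have := (aux_idx_le hne _).2 hη
    simp only [hG]
    rw [max_eq_left this]
  have hU : IntegrableOn G (⋃ n, S n) μ := by
    refine integrableOn_iUnion_of_summable_integral_norm (fun n => ?_) ?_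
    · exact (integrableOn_const (hSfin n)).congr_fun (fun η hη => (hSG n η hη).symm) (hSm n)
    · have := (hFs x γI).mul_right ‖ψ x‖
      refine this.congr fun n => ?_
      rw [setIntegral_congr_fun (hSm n) (fun η hη => by rw [hSG n η hη]), setIntegral_const, hSv,
        norm_mul, norm_neg, smul_eq_mul]
      ring
  rw [← integrableOn_univ]
  refine (hball.union hU).mono_set ?_
  intro η _
  by_cases h : η ∈ Metric.closedBall x ((p : ℝ) ^ γI)
  · exact Or.inl h
  · right
    have hne : x ≠ η := by
      rintro rfl
      exact h (Metric.mem_closedBall_self (zpow_pos aux_p_pos _).le)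
    have a := mt (aux_idx_le hne γI).1 h
    refine Set.mem_iUnion.2 ⟨(supIdx x η - (γI + 1)).toNat, ?_, ?_⟩
    · rw [Metric.mem_closedBall, ← aux_idx_le hne]; omega
    · rw [Metric.mem_closedBall, ← aux_idx_le hne]; omega

end Aux

/-- If `φ` is a wavelet with ball `I = B(c, p^γI)` and `ψ` a wavelet with ball
`J = B(c, p^γJ)` where `J ⊊ I` (i.e. `γJ < γI`), then `𝓘[φ,ψ](x) = ψ(x) φ(x) Φ_{I,J}`. -/
theorem I_integral_nested_balls {p : ℕ} [Fact p.Prime]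
    [MeasurableSpace ℚ_[p]] [BorelSpace ℚ_[p]]
    (μ : Measure ℚ_[p]) [μ.IsAddHaarMeasure] (hμ : μ (Metric.closedBall 0 1) = 1)
    (F : ℚ_[p] → ℤ → ℂ) (hF : IsBallKernel F) (hFs : KernelSummable F)
    (φ ψ : ℚ_[p] → ℂ) (c : ℚ_[p]) (γI γJ : ℤ) (hγ : γJ < γI)
    (hφ : IsWavelet μ φ c γI) (hψ : IsWavelet μ ψ c γJ) :
    ∀ x : ℚ_[p], IIntegral μ F φ ψ x = ψ x * φ x * PhiIJ F c γI γJ := by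
  intro x
  unfold IIntegral
  have hpγ : (p : ℝ) ^ γJ ≤ (p : ℝ) ^ (γI - 1) :=
    zpow_le_zpow_right₀ aux_p_one_lt.le (by omega)
  have hpγ' : (p : ℝ) ^ (γI - 1) ≤ (p : ℝ) ^ γI :=
    zpow_le_zpow_right₀ aux_p_one_lt.le (by omega)
  by_cases hx : dist x c ≤ (p : ℝ) ^ γJ
  swap
  · have hψx : ψ x = 0 := hψ.1 x (not_le.1 hx)
    have hxc : x ≠ c := by
      rintro rfl
      exact hx (by simpa using (zpow_pos (aux_p_pos (p := p)) γJ).le)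
    rw [hψx]
    have : ∀ᵐ ξ ∂μ, (∫ η, F x (sup3Idx x ξ η) * (φ ξ * (ψ η - 0)) ∂μ) = 0 := by
      filter_upwards [aux_ne μ x] with ξ hξ
      have : ∀ᵐ η ∂μ, F x (sup3Idx x ξ η) * (φ ξ * (ψ η - 0)) =
          (F x (max (supIdx x ξ) (supIdx x c)) * φ ξ) * ψ η := by
        filter_upwards [aux_ne μ x, aux_ne μ ξ] with η h1 h2
        by_cases h0 : ψ η = 0
        · simp [h0]
        have hη : dist η c ≤ (p : ℝ) ^ γJ := by
          by_contra hc
          exact h0 (hψ.1 η (not_le.1 hc))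
        have e : supIdx x η = supIdx x c := by
          have hb := mt (aux_idx_le hxc γJ).1 (by rwa [dist_comm])
          apply le_antisymm
          · rw [aux_idx_le h1]
            refine (aux_ultra η c x).trans (max_le (hη.trans ?_) ((aux_idx_le hxc _).1 le_rfl))
            exact zpow_le_zpow_right₀ aux_p_one_lt.le (by omega)
          · have q : supIdx x c ≤ max γJ (supIdx x η) := by
              rw [aux_idx_le hxc]
              refine (aux_ultra c η x).trans (max_le ?_ ((aux_idx_le h1 _).1 (le_max_right _ _)))
              rw [dist_comm]
              exact hη.trans (zpow_le_zpow_right₀ aux_p_one_lt.le (le_max_left _ _))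
            omega
        rw [aux_sup3 hξ h1 h2, e]; ring
      rw [integral_congr_ae this, integral_const_mul, hψ.2.2.1, mul_zero]
    rw [integral_congr_ae this]; simp
  -- main case
  set G := fun η => F x (max γI (supIdx x η)) * (ψ η - ψ x) with hG
  have hGi : Integrable G μ := aux_Gint μ hμ hFs hγ hψ x hx
  set B : ℤ → Set ℚ_[p] := fun m => Metric.closedBall x ((p : ℝ) ^ m) with hB
  have hBm : ∀ m, MeasurableSet (B m) := fun m => Metric.isClosed_closedBall.measurableSet
  have hφi := aux_int μ hφ
  have hψi : ∀ m, Integrable ((B m).indicator (fun η => ψ η - ψ x)) μ := fun m => by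
    rw [integrable_indicator_iff (hBm m)]
    exact (aux_int μ hψ).integrableOn.sub (integrableOn_const (aux_fin μ x _))
  have hφB : ∀ m ∈ Finset.Ico γJ γI,
      ∫ ξ, (B m).indicator φ ξ ∂μ = φ x * (((p : ℝ) ^ m : ℝ) : ℂ) := by
    intro m hm
    rw [Finset.mem_Ico] at hm
    rw [integral_indicator (hBm m), setIntegral_congr_fun (g := fun _ => φ x) (hBm m),
      setIntegral_const, aux_vol μ hμ, Complex.real_smul, mul_comm]
    intro ξ hξ
    exact hφ.2.1 ξ x (le_trans hξ (zpow_le_zpow_right₀ aux_p_one_lt.le (by omega)))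
  have hψB : ∀ m ∈ Finset.Ico γJ γI,
      ∫ η, (B m).indicator (fun η => ψ η - ψ x) η ∂μ = -ψ x * (((p : ℝ) ^ m : ℝ) : ℂ) := by
    intro m hm
    rw [Finset.mem_Ico] at hm
    rw [integral_indicator (hBm m), integral_sub (aux_int μ hψ).integrableOn
      (integrableOn_const (aux_fin μ x _)), setIntegral_const, aux_vol μ hμ,
      setIntegral_eq_integral_of_forall_compl_eq_zero, hψ.2.2.1, Complex.real_smul]
    · ring
    · intro η hη
      apply hψ.1
      by_contra hcon
      apply hη
      have := (aux_ultra η c x).trans (max_le (not_lt.1 hcon) (dist_comm x c ▸ hx))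
      exact le_trans this (zpow_le_zpow_right₀ aux_p_one_lt.le hm.1)
  have key : ∀ᵐ ξ ∂μ, (∫ η, F x (sup3Idx x ξ η) * (φ ξ * (ψ η - ψ x)) ∂μ) =
      φ ξ * (∫ η, G η ∂μ) + ∑ m ∈ Finset.Ico γJ γI,
        (B m).indicator φ ξ * ((F x m - F x (m + 1)) * (-ψ x * (((p : ℝ) ^ m : ℝ) : ℂ))) := by
    filter_upwards [aux_ne μ x] with ξ hξ
    have h : ∀ᵐ η ∂μ, F x (sup3Idx x ξ η) * (φ ξ * (ψ η - ψ x)) =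
        φ ξ * G η + ∑ m ∈ Finset.Ico γJ γI,
          ((B m).indicator φ ξ * (F x m - F x (m + 1))) *
            (B m).indicator (fun η => ψ η - ψ x) η := by
      filter_upwards [aux_ne μ x, aux_ne μ ξ] with η h1 h2
      rw [aux_sup3 hξ h1 h2]
      by_cases hφ0 : φ ξ = 0
      · have : ∀ m, (B m).indicator φ ξ = 0 := fun m => by
          by_cases hm : ξ ∈ B m <;> simp [hm, hφ0]
        simp [hφ0, this]
      by_cases hψ0 : ψ η = ψ x
      · have : ∀ m, (B m).indicator (fun η => ψ η - ψ x) η = 0 := fun m => by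
          by_cases hm : η ∈ B m <;> simp [hm, hψ0]
        simp [hG, hψ0, this]
      have hk : supIdx x ξ ≤ γI := by
        rw [aux_idx_le hξ]
        have h3 : dist ξ c ≤ (p : ℝ) ^ γI := by
          by_contra hc
          exact hφ0 (hφ.1 ξ (not_le.1 hc))
        exact (aux_ultra ξ c x).trans (max_le h3 (dist_comm x c ▸ (hx.trans (hpγ.trans hpγ'))))
      have hs : γJ ≤ supIdx x η := by
        by_contra hc
        exact hψ0 (hψ.2.1 η x ((aux_idx_le h1 _).1 (by omega)))
      have hterm : ∀ m, ((B m).indicator φ ξ * (F x m - F x (m + 1))) *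
            (B m).indicator (fun η => ψ η - ψ x) η =
          if max (supIdx x ξ) (supIdx x η) ≤ m then
            (F x m - F x (m + 1)) * (φ ξ * (ψ η - ψ x)) else 0 := by
        intro m
        have m1 : ξ ∈ B m ↔ supIdx x ξ ≤ m := (aux_idx_le hξ m).symm
        have m2 : η ∈ B m ↔ supIdx x η ≤ m := (aux_idx_le h1 m).symm
        classical
        rw [Set.indicator_apply, Set.indicator_apply]
        simp only [m1, m2, max_le_iff]
        by_cases c1 : supIdx x ξ ≤ m <;> by_cases c2 : supIdx x η ≤ m <;> simp [c1, c2]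
        ring
      simp only [hterm, hG]
      rw [← Finset.sum_filter, ← Finset.sum_mul]
      set M := max (supIdx x ξ) (supIdx x η) with hM
      have hfil : (Finset.Ico γJ γI).filter (fun m => M ≤ m) = Finset.Ico M γI := by
        ext m; simp only [Finset.mem_filter, Finset.mem_Ico]; omega
      rw [hfil]
      by_cases hMI : M ≤ γI
      · rw [aux_tele _ _ _ hMI, max_eq_left (by omega)]; ring
      · rw [Finset.Ico_eq_empty (by omega)]
        have : max γI (supIdx x η) = M := by omega
        rw [this]; simp; ring
    rw [integral_congr_ae h, integral_add (hGi.const_mul _)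
      (integrable_finsetSum _ fun m _ => (hψi m).const_mul _), integral_const_mul,
      integral_finsetSum _ fun m _ => (hψi m).const_mul _]
    congr 1
    refine Finset.sum_congr rfl fun m hm => ?_
    rw [integral_const_mul, hψB m hm]; ring
  have hφBi : ∀ m, Integrable ((B m).indicator φ) μ := fun m => hφi.indicator (hBm m)
  rw [integral_congr_ae key, integral_add (hφi.mul_const _)
    (integrable_finsetSum _ fun m _ => (hφBi m).mul_const _), integral_mul_const, hφ.2.2.1,
    zero_mul, zero_add, integral_finsetSum _ fun m _ => (hφBi m).mul_const _]
  have hFc : ∀ m, γJ ≤ m → F x m = F c m := fun m hm =>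
    hF x c m (hx.trans (zpow_le_zpow_right₀ aux_p_one_lt.le hm))
  unfold PhiIJ
  rw [← aux_phi (F c) γJ γI hγ, Finset.mul_sum]
  refine Finset.sum_congr rfl fun m hm => ?_
  have hm' := Finset.mem_Ico.1 hm
  rw [integral_mul_const, hφB m hm, hFc m hm'.1, hFc (m + 1) (by omega), two_mul,
    zpow_add₀ aux_p_pos.ne']
  push_cast
  ring
end

section
/- For each ball B of ℚ_p, the space V₀(B) ⊂ L²(ℚ_p, μ) of functions vanishing outside B, constant on each of the p maximal subballs of B, and of mean zero has dimension p − 1. Moreover, if for every ball B an orthonormal basis {ψ_{B,1}, …, ψ_{B,p−1}} of V₀(B) is chosen, then the family {ψ_{B,j} : B a ball of ℚ_p, 1 ≤ j ≤ p − 1} is an orthonormal Hilbert basis of L²(ℚ_p, μ). -/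
open MeasureTheory

/-- The pointwise conditions defining `V₀(B(c, p^γ))`: vanishing outside the ball,
constancy on each of the `p` maximal subballs (balls of radius `p^(γ-1)`), zero mean. -/
def V0pred {p : ℕ} [Fact p.Prime] [MeasurableSpace ℚ_[p]] (μ : Measure ℚ_[p])
    (c : ℚ_[p]) (γ : ℤ) (g : ℚ_[p] → ℂ) : Prop :=
  (∀ x, (p : ℝ) ^ γ < dist x c → g x = 0) ∧
    (∀ x y, dist x y ≤ (p : ℝ) ^ (γ - 1) → g x = g y) ∧
    (∫ x, g x ∂μ) = 0

theorem V0pred.continuous' {p : ℕ} [Fact p.Prime] {γ : ℤ} {g : ℚ_[p] → ℂ}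
    (h : ∀ x y : ℚ_[p], dist x y ≤ (p : ℝ) ^ (γ - 1) → g x = g y) : Continuous g := by
  have hp : (0 : ℝ) < p := by exact_mod_cast (Fact.out : p.Prime).pos
  rw [continuous_iff_continuousAt]
  intro x
  apply Filter.EventuallyEq.continuousAt (y := g x)
  filter_upwards [Metric.closedBall_mem_nhds x (zpow_pos hp (γ - 1))] with y hy
  exact h y x hy

theorem V0pred.integrable {p : ℕ} [Fact p.Prime] [MeasurableSpace ℚ_[p]] [BorelSpace ℚ_[p]]
    {μ : MeasureTheory.Measure ℚ_[p]} [MeasureTheory.IsFiniteMeasureOnCompacts μ]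
    {c : ℚ_[p]} {γ : ℤ} {g : ℚ_[p] → ℂ}
    (h0 : ∀ x, (p : ℝ) ^ γ < dist x c → g x = 0)
    (h1 : ∀ x y : ℚ_[p], dist x y ≤ (p : ℝ) ^ (γ - 1) → g x = g y) :
    MeasureTheory.Integrable g μ :=
  (V0pred.continuous' h1).integrable_of_hasCompactSupport
    (HasCompactSupport.intro (isCompact_closedBall c ((p : ℝ) ^ γ))
      (fun x hx => h0 x (by simpa [Metric.mem_closedBall, not_le] using hx)))

/-- `V₀(B(c, p^γ))` as a subspace of `L²(ℚ_p, μ)`: the (classes of) functions vanishing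
outside `B(c, p^γ)`, constant on each of the `p` maximal subballs, with zero mean. -/
noncomputable def V0 {p : ℕ} [Fact p.Prime] [MeasurableSpace ℚ_[p]] [BorelSpace ℚ_[p]]
    (μ : Measure ℚ_[p]) [MeasureTheory.IsFiniteMeasureOnCompacts μ] (c : ℚ_[p]) (γ : ℤ) :
    Submodule ℂ (Lp ℂ 2 μ) where
  carrier := {f : Lp ℂ 2 μ | ∃ g : ℚ_[p] → ℂ, (↑f : ℚ_[p] → ℂ) =ᵐ[μ] g ∧ V0pred μ c γ g}
  zero_mem' := ⟨0, Lp.coeFn_zero ℂ 2 μ, fun _ _ => rfl, fun _ _ _ => rfl, by simp⟩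
  add_mem' := by
    rintro f₁ f₂ ⟨g₁, hg₁, hv₁, hc₁, hm₁⟩ ⟨g₂, hg₂, hv₂, hc₂, hm₂⟩
    refine ⟨g₁ + g₂, (Lp.coeFn_add f₁ f₂).trans ?_, fun x hx => ?_, fun x y hxy => ?_, ?_⟩
    · filter_upwards [hg₁, hg₂] with x h1 h2
      simp [h1, h2]
    · simp [Pi.add_apply, hv₁ x hx, hv₂ x hx]
    · simp [Pi.add_apply, hc₁ x y hxy, hc₂ x y hxy]
    · simp only [Pi.add_apply]
      rw [MeasureTheory.integral_add (V0pred.integrable hv₁ hc₁) (V0pred.integrable hv₂ hc₂)]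
      simp [hm₁, hm₂]
  smul_mem' := by
    rintro a f ⟨g, hg, hv, hc, hm⟩
    refine ⟨a • g, (Lp.coeFn_smul a f).trans ?_, fun x hx => ?_, fun x y hxy => ?_, ?_⟩
    · filter_upwards [hg] with x h1
      simp [h1]
    · simp [Pi.smul_apply, hv x hx]
    · simp [Pi.smul_apply, hc x y hxy]
    · simp only [Pi.smul_apply]
      rw [MeasureTheory.integral_smul]
      simp [hm]

/-- The type of balls of `ℚ_p`. -/
def PadicBall (p : ℕ) [Fact p.Prime] : Type :=
  {S : Set ℚ_[p] // ∃ (c : ℚ_[p]) (γ : ℤ), S = Metric.closedBall c ((p : ℝ) ^ γ)}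

set_option linter.unusedSectionVars false

namespace WaveletAux

variable {p : ℕ} [Fact p.Prime]

lemma p_pos : (0 : ℝ) < p := by exact_mod_cast (Fact.out : p.Prime).pos

/-- The centers of the maximal subballs. -/
noncomputable def ctr (c : ℚ_[p]) (γ : ℤ) (i : Fin p) : ℚ_[p] := c + (i : ℕ) * (p : ℚ_[p]) ^ (-γ)

lemma dist_ctr (c : ℚ_[p]) (γ : ℤ) (i : Fin p) : dist (ctr c γ i) c ≤ (p : ℝ) ^ γ := by
  rw [dist_eq_norm, ctr, add_sub_cancel_left, norm_mul, Padic.norm_p_zpow, neg_neg]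
  have h1 : ‖((i : ℕ) : ℚ_[p])‖ ≤ 1 := by
    have := Padic.norm_int_le_one (p := p) (i : ℕ)
    exact_mod_cast this
  have := zpow_pos (p_pos (p := p)) γ
  nlinarith

lemma existsUnique_ctr (c : ℚ_[p]) (γ : ℤ) (x : ℚ_[p]) (hx : dist x c ≤ (p : ℝ) ^ γ) :
    ∃! i : Fin p, dist x (ctr c γ i) ≤ (p : ℝ) ^ (γ - 1) := by
  have hp := p_pos (p := p)
  have hp0 : (p : ℚ_[p]) ≠ 0 := by exact_mod_cast (Fact.out : p.Prime).ne_zero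
  have hpR : (p : ℝ) ≠ 0 := hp.ne'
  have hnorm : ‖(x - c) * (p : ℚ_[p]) ^ γ‖ ≤ 1 := by
    rw [norm_mul, Padic.norm_p_zpow, ← dist_eq_norm]
    calc dist x c * (p : ℝ) ^ (-γ) ≤ (p : ℝ) ^ γ * (p : ℝ) ^ (-γ) := by
          gcongr
      _ = 1 := by rw [← zpow_add₀ hpR]; simp
  obtain ⟨z, hz⟩ : ∃ z : ℤ_[p], (z : ℚ_[p]) = (x - c) * (p : ℚ_[p]) ^ γ := ⟨⟨_, hnorm⟩, rfl⟩
  have key : ∀ i : ℕ, dist x (c + (i : ℕ) * (p : ℚ_[p]) ^ (-γ)) ≤ (p : ℝ) ^ (γ - 1) ↔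
      z - (i : ℕ) ∈ IsLocalRing.maximalIdeal ℤ_[p] := by
    intro i
    rw [IsLocalRing.mem_maximalIdeal, PadicInt.mem_nonunits, PadicInt.norm_def]
    have e : (((z - (i : ℕ) : ℤ_[p])) : ℚ_[p]) =
        (x - (c + (i : ℕ) * (p : ℚ_[p]) ^ (-γ))) * (p : ℚ_[p]) ^ γ := by
      push_cast
      rw [hz]
      have : (p : ℚ_[p]) ^ (-γ) * (p : ℚ_[p]) ^ γ = 1 := by
        rw [← zpow_add₀ hp0]; simp
      linear_combination (i : ℚ_[p]) * this
    rw [e, norm_mul, Padic.norm_p_zpow, ← dist_eq_norm, dist_eq_norm,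
      ← Padic.norm_lt_pow_iff_norm_le_pow_sub_one, zpow_neg (p : ℝ), ← div_eq_mul_inv _ ((p : ℝ) ^ γ),
      div_lt_one (zpow_pos hp γ)]
  obtain ⟨n, ⟨hn, hn'⟩, hu⟩ := PadicInt.existsUnique_mem_range z
  refine ⟨⟨n, hn⟩, (key n).2 hn', ?_⟩
  intro j hj
  exact Fin.ext (hu j ⟨j.2, (key j).1 hj⟩)

variable [MeasurableSpace ℚ_[p]] [BorelSpace ℚ_[p]]
    (μ : Measure ℚ_[p]) [μ.IsAddHaarMeasure]

/-- The ball of index `γ`. -/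
abbrev bl (c : ℚ_[p]) (γ : ℤ) : Set ℚ_[p] := Metric.closedBall c ((p : ℝ) ^ γ)

/-- The measure of the ball of index `γ`. -/
noncomputable def ms (γ : ℤ) : ℝ := μ.real (bl (0 : ℚ_[p]) γ)

lemma bl_ne_top (c : ℚ_[p]) (γ : ℤ) : μ (bl c γ) ≠ ⊤ :=
  (isCompact_closedBall c _).measure_lt_top.ne

lemma real_bl (c : ℚ_[p]) (γ : ℤ) : μ.real (bl c γ) = ms μ γ := by
  have : bl c γ = (fun x => c + x) '' (bl 0 γ) := by
    simp [bl]
  unfold ms Measure.real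
  rw [this, Set.image_add_left, measure_preimage_add]

lemma ms_pos (γ : ℤ) : 0 < ms μ γ := by
  unfold ms Measure.real
  refine ENNReal.toReal_pos ?_ (bl_ne_top μ _ _)
  exact (Metric.measure_closedBall_pos μ _ (zpow_pos p_pos γ)).ne'

lemma pow_le (γ : ℤ) : (p : ℝ) ^ (γ - 1) ≤ (p : ℝ) ^ γ :=
  zpow_le_zpow_right₀ (by exact_mod_cast (Fact.out : p.Prime).one_le) (by omega)

lemma tri {x y z : ℚ_[p]} {r : ℝ} (h1 : dist x y ≤ r) (h2 : dist y z ≤ r) : dist x z ≤ r :=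
  (dist_triangle_max x y z).trans (max_le h1 h2)

lemma sub_disj (c : ℚ_[p]) (γ : ℤ) {i j : Fin p} (hij : i ≠ j) :
    Disjoint (bl (ctr c γ i) (γ - 1)) (bl (ctr c γ j) (γ - 1)) := by
  rw [Set.disjoint_left]
  intro x hi hj
  rw [Metric.mem_closedBall] at hi hj
  have hx : dist x c ≤ (p : ℝ) ^ γ := tri (hi.trans (pow_le γ)) (dist_ctr c γ i)
  exact hij ((existsUnique_ctr c γ x hx).unique hi hj)

lemma bl_eq (c : ℚ_[p]) (γ : ℤ) : bl c γ = ⋃ i ∈ Finset.univ, bl (ctr c γ i) (γ - 1) := by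
  ext x
  simp only [Finset.mem_univ, Set.iUnion_true, Set.mem_iUnion, Metric.mem_closedBall]
  constructor
  · intro h; exact (existsUnique_ctr c γ x h).exists
  · rintro ⟨i, hi⟩; exact tri (hi.trans (pow_le γ)) (dist_ctr c γ i)

lemma ms_rec (γ : ℤ) : ms μ γ = p * ms μ (γ - 1) := by
  conv_lhs => rw [ms, bl_eq]
  rw [measureReal_biUnion_finset (h := fun i _ => bl_ne_top μ _ _)]
  · simp [real_bl]
  · intro i _ j _ hij; exact sub_disj _ _ hij
  · intro i _; exact measurableSet_closedBall

/-- Indicator of a ball in `L²`. -/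
noncomputable def ind (c : ℚ_[p]) (γ : ℤ) : Lp ℂ 2 μ :=
  indicatorConstLp 2 (s := bl c γ) measurableSet_closedBall (bl_ne_top μ c γ) 1

lemma ind_ae (c : ℚ_[p]) (γ : ℤ) :
    (ind μ c γ : ℚ_[p] → ℂ) =ᵐ[μ] (bl c γ).indicator (fun _ => (1 : ℂ)) :=
  indicatorConstLp_coeFn

lemma inner_ind (c : ℚ_[p]) (γ : ℤ) (f : Lp ℂ 2 μ) :
    inner ℂ (ind μ c γ) f = ∫ x in bl c γ, f x ∂μ :=
  L2.inner_indicatorConstLp_one _ _ f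

lemma norm_ind_sq (c : ℚ_[p]) (γ : ℤ) : ‖ind μ c γ‖ ^ 2 = ms μ γ := by
  unfold ind
  rw [norm_indicatorConstLp (by simp) (by simp), real_bl, norm_one, one_mul, ← Real.rpow_natCast,
    ← Real.rpow_mul (ms_pos μ γ).le]
  simp

lemma inner_ind_disj {c c' : ℚ_[p]} {γ γ' : ℤ} (h : Disjoint (bl c γ) (bl c' γ')) :
    inner ℂ (ind μ c γ) (ind μ c' γ') = 0 := by
  rw [inner_ind]
  rw [setIntegral_congr_ae (g := fun _ => (0 : ℂ)) measurableSet_closedBall]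
  · simp
  · filter_upwards [ind_ae μ c' γ'] with x hx hxm
    rw [hx, Set.indicator_of_notMem (Set.disjoint_left.1 h hxm)]

lemma ind_ne_zero (c : ℚ_[p]) (γ : ℤ) : ind μ c γ ≠ 0 := by
  intro h
  have := norm_ind_sq μ c γ
  rw [h] at this
  have := ms_pos μ γ
  simp_all

lemma integral_indicator_bl (c : ℚ_[p]) (γ : ℤ) :
    ∫ x, (bl c γ).indicator (fun _ => (1 : ℂ)) x ∂μ = (ms μ γ : ℂ) := by
  rw [integral_indicator measurableSet_closedBall]
  simp [real_bl]

lemma integrable_indicator_bl (c : ℚ_[p]) (γ : ℤ) :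
    Integrable ((bl c γ).indicator (fun _ => (1 : ℂ))) μ := by
  rw [integrable_indicator_iff measurableSet_closedBall]
  exact integrableOn_const (bl_ne_top μ c γ)

/-- The subball indicators. -/
noncomputable def sb (c : ℚ_[p]) (γ : ℤ) (i : Fin p) : Lp ℂ 2 μ := ind μ (ctr c γ i) (γ - 1)

lemma sb_li (c : ℚ_[p]) (γ : ℤ) : LinearIndependent ℂ (sb μ c γ) :=
  linearIndependent_of_ne_zero_of_inner_eq_zero (fun _ => ind_ne_zero μ _ _)
    (fun _ _ hij => inner_ind_disj μ (sub_disj c γ hij))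

lemma lincomb_ae (c : ℚ_[p]) (γ : ℤ) (v : Fin p → ℂ) :
    (Fintype.linearCombination ℂ (sb μ c γ) v : ℚ_[p] → ℂ) =ᵐ[μ]
      fun x => ∑ i, v i * (bl (ctr c γ i) (γ - 1)).indicator (fun _ => (1 : ℂ)) x := by
  rw [Fintype.linearCombination_apply]
  have h1 := Lp.coeFn_finsetSum Finset.univ (fun i => v i • sb μ c γ i)
  have h2 : ∀ i, ∀ᵐ x ∂μ, (v i • sb μ c γ i : Lp ℂ 2 μ) x =
      v i * (bl (ctr c γ i) (γ - 1)).indicator (fun _ => (1 : ℂ)) x := by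
    intro i
    filter_upwards [Lp.coeFn_smul (v i) (sb μ c γ i), ind_ae μ (ctr c γ i) (γ - 1)] with x h h'
    rw [h, Pi.smul_apply, sb, h', smul_eq_mul]
  filter_upwards [h1, ae_all_iff.2 h2] with x h h'
  rw [h]
  simp [h']

lemma integral_lincomb (c : ℚ_[p]) (γ : ℤ) (v : Fin p → ℂ) :
    ∫ x, ∑ i, v i * (bl (ctr c γ i) (γ - 1)).indicator (fun _ => (1 : ℂ)) x ∂μ
      = (∑ i, v i) * ms μ (γ - 1) := by
  rw [integral_finsetSum _ (fun i _ => (integrable_indicator_bl μ _ _).const_mul _), Finset.sum_mul]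
  refine Finset.sum_congr rfl fun i _ => ?_
  rw [integral_const_mul, integral_indicator_bl]

/-- The sum functional. -/
noncomputable def sm (p : ℕ) : (Fin p → ℂ) →ₗ[ℂ] ℂ := ∑ i, LinearMap.proj i

lemma sm_apply (p : ℕ) (v : Fin p → ℂ) : sm p v = ∑ i, v i := by simp [sm]

lemma V0_eq (c : ℚ_[p]) (γ : ℤ) :
    V0 μ c γ = (LinearMap.ker (sm p)).map (Fintype.linearCombination ℂ (sb μ c γ)) := by
  have hm : (ms μ (γ - 1) : ℂ) ≠ 0 := by exact_mod_cast (ms_pos μ (γ - 1)).ne'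
  ext f
  rw [Submodule.mem_map]
  constructor
  · rintro ⟨g, hfg, h0, h1, h2⟩
    have hg : g = fun x => ∑ i, g (ctr c γ i) *
        (bl (ctr c γ i) (γ - 1)).indicator (fun _ => (1 : ℂ)) x := by
      funext x
      by_cases hx : dist x c ≤ (p : ℝ) ^ γ
      · obtain ⟨i, hi, hu⟩ := existsUnique_ctr c γ x hx
        rw [Finset.sum_eq_single i]
        · rw [Set.indicator_of_mem (by exact hi), mul_one]
          exact h1 _ _ hi
        · intro j _ hj
          rw [Set.indicator_of_notMem, mul_zero]
          intro hxj
          exact hj (hu j hxj)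
        · simp
      · rw [h0 x (not_le.1 hx), Finset.sum_eq_zero]
        intro i _
        rw [Set.indicator_of_notMem, mul_zero]
        intro hxi
        exact hx (tri ((Metric.mem_closedBall.1 hxi).trans (pow_le γ)) (dist_ctr c γ i))
    refine ⟨fun i => g (ctr c γ i), ?_, ?_⟩
    · rw [hg, integral_lincomb] at h2
      rw [LinearMap.mem_ker, sm_apply]
      exact (mul_eq_zero.1 h2).resolve_right hm
    · apply Lp.ext
      refine (lincomb_ae μ c γ _).trans ?_
      rw [← hg]
      exact hfg.symm
  · rintro ⟨v, hv, rfl⟩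
    refine ⟨_, lincomb_ae μ c γ v, ?_, ?_, ?_⟩
    · intro x hx
      beta_reduce
      rw [Finset.sum_eq_zero]
      intro i _
      rw [Set.indicator_of_notMem, mul_zero]
      intro hxi
      exact (not_le.2 hx) (tri ((Metric.mem_closedBall.1 hxi).trans (pow_le γ)) (dist_ctr c γ i))
    · intro x y hxy
      refine Finset.sum_congr rfl fun i _ => ?_
      congr 1
      have : x ∈ bl (ctr c γ i) (γ - 1) ↔ y ∈ bl (ctr c γ i) (γ - 1) := by
        rw [Metric.mem_closedBall, Metric.mem_closedBall]
        exact ⟨fun h => tri (by rwa [dist_comm]) h, fun h => tri hxy h⟩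
      by_cases hx : x ∈ bl (ctr c γ i) (γ - 1)
      · rw [Set.indicator_of_mem hx, Set.indicator_of_mem (this.1 hx)]
      · rw [Set.indicator_of_notMem hx, Set.indicator_of_notMem (fun h => hx (this.2 h))]
    · rw [LinearMap.mem_ker, sm_apply] at hv
      rw [integral_lincomb, hv, zero_mul]

lemma finrank_V0 (c : ℚ_[p]) (γ : ℤ) : Module.finrank ℂ (V0 μ c γ) = p - 1 := by
  rw [V0_eq]
  rw [← (Submodule.equivMapOfInjective _ (sb_li μ c γ).fintypeLinearCombination_injective
    (LinearMap.ker (sm p))).finrank_eq]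
  have hp := (Fact.out : p.Prime).pos
  have hs : Function.Surjective (sm p) := by
    intro z
    refine ⟨Pi.single ⟨0, hp⟩ z, ?_⟩
    rw [sm_apply]; simp
  have h := LinearMap.finrank_range_add_finrank_ker (sm p)
  rw [LinearMap.range_eq_top.2 hs] at h
  simp at h
  omega

/-- Orthogonality, ordered indices. -/
lemma orth_lt {c c' : ℚ_[p]} {γ γ' : ℤ} (hlt : γ < γ') {f f' : Lp ℂ 2 μ}
    (hf : f ∈ V0 μ c γ) (hf' : f' ∈ V0 μ c' γ') : inner ℂ f' f = 0 := by
  obtain ⟨g, hfg, h0, h1, h2⟩ := hf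
  obtain ⟨g', hfg', h0', h1', h2'⟩ := hf'
  rw [L2.inner_def]
  have : ∫ x, inner ℂ (f' x) (f x) ∂μ = ∫ x, (starRingEnd ℂ) (g' c) * g x ∂μ := by
    apply integral_congr_ae
    filter_upwards [hfg, hfg'] with x hx hx'
    rw [hx, hx', RCLike.inner_apply, mul_comm]
    by_cases hxc : dist x c ≤ (p : ℝ) ^ γ
    · rw [h1' x c (hxc.trans (zpow_le_zpow_right₀
        (by exact_mod_cast (Fact.out : p.Prime).one_le) (by omega)))]
    · rw [h0 x (not_le.1 hxc)]; simp
  rw [this, integral_const_mul, h2, mul_zero]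

lemma orth_disj {c c' : ℚ_[p]} {γ γ' : ℤ} (hd : Disjoint (bl c γ) (bl c' γ')) {f f' : Lp ℂ 2 μ}
    (hf : f ∈ V0 μ c γ) (hf' : f' ∈ V0 μ c' γ') : inner ℂ f f' = 0 := by
  obtain ⟨g, hfg, h0, h1, h2⟩ := hf
  obtain ⟨g', hfg', h0', h1', h2'⟩ := hf'
  rw [L2.inner_def, integral_eq_zero_of_ae]
  filter_upwards [hfg, hfg'] with x hx hx'
  rw [hx, hx', RCLike.inner_apply]
  by_cases hxc : dist x c ≤ (p : ℝ) ^ γ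
  · have : ¬ dist x c' ≤ (p : ℝ) ^ γ' := Set.disjoint_left.1 hd hxc
    rw [h0' x (not_le.1 this)]; simp
  · rw [h0 x (not_le.1 hxc)]; simp

lemma orth_ne {c c' : ℚ_[p]} {γ γ' : ℤ} (hd : bl c γ ≠ bl c' γ') {f f' : Lp ℂ 2 μ}
    (hf : f ∈ V0 μ c γ) (hf' : f' ∈ V0 μ c' γ') : inner ℂ f f' = 0 := by
  rcases lt_trichotomy γ γ' with h | h | h
  · rw [← inner_conj_symm, orth_lt μ h hf hf', map_zero]
  · subst h
    exact orth_disj μ ((IsUltrametricDist.closedBall_eq_or_disjoint c c' _).resolve_left hd) hf hf'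
  · exact orth_lt μ h hf' hf

lemma step_mem (c : ℚ_[p]) (γ : ℤ) : (p : ℂ) • ind μ c (γ - 1) - ind μ c γ ∈ V0 μ c γ := by
  refine ⟨fun x => p * (bl c (γ - 1)).indicator (fun _ => (1 : ℂ)) x -
    (bl c γ).indicator (fun _ => (1 : ℂ)) x, ?_, ?_, ?_, ?_⟩
  · filter_upwards [Lp.coeFn_sub ((p : ℂ) • ind μ c (γ - 1)) (ind μ c γ),
      Lp.coeFn_smul (p : ℂ) (ind μ c (γ - 1)), ind_ae μ c γ, ind_ae μ c (γ - 1)] with x a b d e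
    rw [a, Pi.sub_apply, b, Pi.smul_apply, d, e, smul_eq_mul]
  · intro x hx
    beta_reduce
    rw [Set.indicator_of_notMem, Set.indicator_of_notMem]
    · simp
    · exact not_le.2 hx
    · exact fun h => not_le.2 hx ((Metric.mem_closedBall.1 h).trans (pow_le γ))
  · intro x y hxy
    have aux : ∀ δ, (p : ℝ) ^ (γ - 1) ≤ (p : ℝ) ^ δ →
        (bl c δ).indicator (fun _ => (1 : ℂ)) x = (bl c δ).indicator (fun _ => (1 : ℂ)) y := by
      intro δ hδ
      have : x ∈ bl c δ ↔ y ∈ bl c δ := by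
        rw [Metric.mem_closedBall, Metric.mem_closedBall]
        exact ⟨fun h => tri (by rw [dist_comm]; exact hxy.trans hδ) h,
          fun h => tri (hxy.trans hδ) h⟩
      by_cases hx : x ∈ bl c δ
      · rw [Set.indicator_of_mem hx, Set.indicator_of_mem (this.1 hx)]
      · rw [Set.indicator_of_notMem hx, Set.indicator_of_notMem (fun h => hx (this.2 h))]
    simp only [aux _ le_rfl, aux _ (pow_le γ)]
  · rw [integral_sub ((integrable_indicator_bl μ _ _).const_mul _) (integrable_indicator_bl μ _ _),
      integral_const_mul, integral_indicator_bl, integral_indicator_bl, ms_rec μ γ]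
    push_cast
    ring

lemma ms_add (γ : ℤ) (n : ℕ) : ms μ (γ + n) = (p : ℝ) ^ n * ms μ γ := by
  induction n with
  | zero => simp
  | succ n ih =>
    rw [ms_rec, show γ + ((n + 1 : ℕ) : ℤ) - 1 = γ + n by push_cast; ring, ih]
    ring

lemma inner_zero (f : Lp ℂ 2 μ) (hf : ∀ c γ, ∀ h ∈ V0 μ c γ, inner ℂ h f = 0)
    (c : ℚ_[p]) (γ : ℤ) : inner ℂ (ind μ c γ) f = 0 := by
  have hrec : ∀ δ, inner ℂ (ind μ c δ) f = p * inner ℂ (ind μ c (δ - 1)) f := by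
    intro δ
    have := hf c δ _ (step_mem μ c δ)
    rw [inner_sub_left, inner_smul_left, sub_eq_zero] at this
    simpa using this.symm
  have hn : ∀ n : ℕ, inner ℂ (ind μ c (γ + n)) f = (p : ℂ) ^ n * inner ℂ (ind μ c γ) f := by
    intro n
    induction n with
    | zero => simp
    | succ n ih =>
      rw [hrec, show γ + ((n + 1 : ℕ) : ℤ) - 1 = γ + n by push_cast; ring, ih]
      ring
  by_contra hne
  have ha : 0 < ‖inner ℂ (ind μ c γ) f‖ ^ 2 := by positivity
  have hb : ∀ n : ℕ, (p : ℝ) ^ n * ‖inner ℂ (ind μ c γ) f‖ ^ 2 ≤ ms μ γ * ‖f‖ ^ 2 := by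
    intro n
    have h1 : ‖inner ℂ (ind μ c (γ + n)) f‖ ^ 2 ≤ (‖ind μ c (γ + n)‖ * ‖f‖) ^ 2 := by
      gcongr
      exact norm_inner_le_norm _ _
    rw [hn, mul_pow, norm_ind_sq, ms_add, norm_mul, norm_pow, Complex.norm_natCast] at h1
    have hp := pow_pos (p_pos (p := p)) n
    have : (p : ℝ) ^ n * ((p : ℝ) ^ n * ‖inner ℂ (ind μ c γ) f‖ ^ 2) ≤
        (p : ℝ) ^ n * (ms μ γ * ‖f‖ ^ 2) := by
      calc _ = ((p : ℝ) ^ n * ‖inner ℂ (ind μ c γ) f‖) ^ 2 := by ring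
        _ ≤ _ := h1
        _ = _ := by ring
    exact le_of_mul_le_mul_left this hp
  obtain ⟨n, hn'⟩ := pow_unbounded_of_one_lt (ms μ γ * ‖f‖ ^ 2 / ‖inner ℂ (ind μ c γ) f‖ ^ 2)
    (by exact_mod_cast (Fact.out : p.Prime).one_lt : (1 : ℝ) < p)
  rw [div_lt_iff₀ ha] at hn'
  exact absurd (hb n) (not_le.2 hn')

lemma exists_small {ε : ℝ} (hε : 0 < ε) : ∃ γ : ℤ, (p : ℝ) ^ γ < ε := by
  obtain ⟨n, hn⟩ := exists_pow_lt_of_lt_one hε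
    (inv_lt_one_of_one_lt₀ (by exact_mod_cast (Fact.out : p.Prime).one_lt : (1 : ℝ) < p))
  exact ⟨-n, by simpa using hn⟩

lemma basis : TopologicalSpace.IsTopologicalBasis
    {S : Set ℚ_[p] | ∃ c γ, S = bl c γ} := by
  apply TopologicalSpace.isTopologicalBasis_of_isOpen_of_nhds
  · rintro _ ⟨c, γ, rfl⟩
    exact IsUltrametricDist.isOpen_closedBall c (zpow_pos p_pos γ).ne'
  · intro a u ha hu
    obtain ⟨ε, hε, h⟩ := Metric.isOpen_iff.1 hu a ha
    obtain ⟨γ, hγ⟩ := exists_small (p := p) hε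
    exact ⟨_, ⟨a, γ, rfl⟩, Metric.mem_closedBall_self (zpow_pos p_pos γ).le,
      (Metric.closedBall_subset_ball hγ).trans h⟩

lemma inter_bl (c c' : ℚ_[p]) (γ γ' : ℤ) (h : (bl c γ ∩ bl c' γ').Nonempty) :
    ∃ d δ, bl c γ ∩ bl c' γ' = bl d δ := by
  rcases IsUltrametricDist.closedBall_subset_trichotomy c c' ((p : ℝ) ^ γ) ((p : ℝ) ^ γ') with
    h' | h' | h'
  · exact ⟨c, γ, Set.inter_eq_left.2 h'⟩
  · exact ⟨c', γ', Set.inter_eq_right.2 h'⟩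
  · exact absurd h' (Set.not_disjoint_iff_nonempty_inter.2 h)

lemma eq_zero (f : Lp ℂ 2 μ) (hf : ∀ c γ, ∫ x in bl c γ, f x ∂μ = 0) : f = 0 := by
  have hint : ∀ n : ℤ, IntegrableOn f (bl (0 : ℚ_[p]) n) μ := fun n =>
    integrableOn_Lp_of_measure_ne_top f (by norm_num) (bl_ne_top μ _ _)
  have hz : ∀ n : ℤ, ∀ s : Set ℚ_[p], MeasurableSet s → ∫ x in s ∩ bl 0 n, f x ∂μ = 0 := by
    intro n s hs
    have hpi : IsPiSystem {S : Set ℚ_[p] | ∃ c γ, S = bl c γ} := by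
      rintro _ ⟨c, γ, rfl⟩ _ ⟨c', γ', rfl⟩ h
      exact inter_bl c c' γ γ' h
    induction s, hs using MeasurableSpace.induction_on_inter
      (BorelSpace.measurable_eq.trans basis.borel_eq_generateFrom) hpi with
    | empty => simp
    | basic t ht =>
      obtain ⟨c, γ, rfl⟩ := ht
      rcases (bl c γ ∩ bl 0 n).eq_empty_or_nonempty with h | h
      · rw [h]; simp
      · obtain ⟨d, δ, h'⟩ := inter_bl _ _ _ _ h
        rw [h', hf]
    | compl t ht ih =>
      have := integral_inter_add_sdiff (s := bl (0 : ℚ_[p]) n) ht (hint n)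
      rw [hf, Set.inter_comm, ih, zero_add] at this
      rwa [Set.inter_comm, ← Set.sdiff_eq]
    | iUnion g hd hm ih =>
      rw [Set.iUnion_inter]
      have := hasSum_integral_iUnion (μ := μ) (f := f) (s := fun i => g i ∩ bl 0 n)
        (fun i => (hm i).inter measurableSet_closedBall)
        (fun i j hij => (hd hij).mono Set.inter_subset_left Set.inter_subset_left)
        ((hint n).mono_set (Set.iUnion_subset fun i => Set.inter_subset_right))
      simp only [ih] at this
      exact this.unique hasSum_zero
  have hae : ∀ n : ℕ, ∀ᵐ x ∂μ, x ∈ bl (0 : ℚ_[p]) n → f x = 0 := by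
    intro n
    have : f =ᵐ[μ.restrict (bl (0 : ℚ_[p]) n)] 0 := by
      apply Integrable.ae_eq_zero_of_forall_setIntegral_eq_zero (hint n)
      intro s hs _
      rw [Measure.restrict_restrict hs]
      exact hz n s hs
    exact (ae_restrict_iff' measurableSet_closedBall).1 this
  apply Lp.ext
  filter_upwards [ae_all_iff.2 hae, Lp.coeFn_zero ℂ 2 μ] with x hx h0
  rw [h0]
  obtain ⟨n, hn⟩ := pow_unbounded_of_one_lt (dist x 0)
    (by exact_mod_cast (Fact.out : p.Prime).one_lt : (1 : ℝ) < p)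
  exact hx n (by rw [Metric.mem_closedBall, zpow_natCast]; exact hn.le)

end WaveletAux

/-- `dim V₀(B) = p - 1` for every ball `B`, and any choice of orthonormal
bases of the spaces `V₀(B)` over all balls `B` gives an orthonormal Hilbert basis of
`L²(ℚ_p, μ)` (an orthonormal family whose closed linear span is everything). -/
theorem V0_finrank_and_wavelet_hilbert_basis {p : ℕ} [Fact p.Prime]
    [MeasurableSpace ℚ_[p]] [BorelSpace ℚ_[p]]
    (μ : Measure ℚ_[p]) [μ.IsAddHaarMeasure] (hμ : μ (Metric.closedBall 0 1) = 1) :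
    (∀ (c : ℚ_[p]) (γ : ℤ), Module.finrank ℂ (V0 μ c γ) = p - 1) ∧
    (∀ ψ : PadicBall p → Fin (p - 1) → Lp ℂ 2 μ,
      (∀ (c : ℚ_[p]) (γ : ℤ) (B : PadicBall p),
          B.1 = Metric.closedBall c ((p : ℝ) ^ γ) →
          (∀ j, ψ B j ∈ V0 μ c γ) ∧ Orthonormal ℂ (ψ B) ∧
            (∀ f, f ∈ V0 μ c γ → f ∈ Submodule.span ℂ (Set.range (ψ B)))) →
        Orthonormal ℂ (fun q : PadicBall p × Fin (p - 1) => ψ q.1 q.2) ∧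
          (Submodule.span ℂ
            (Set.range (fun q : PadicBall p × Fin (p - 1) => ψ q.1 q.2))).topologicalClosure = ⊤) := by
  refine ⟨WaveletAux.finrank_V0 μ, fun ψ hψ => ⟨?_, ?_⟩⟩
  · constructor
    · rintro ⟨B, j⟩
      obtain ⟨c, γ, hB⟩ := B.2
      exact (hψ c γ B hB).2.1.1 j
    · rintro ⟨B, j⟩ ⟨B', j'⟩ hne
      obtain ⟨c, γ, hB⟩ := B.2
      obtain ⟨c', γ', hB'⟩ := B'.2
      by_cases h : B = B'
      · subst h
        exact (hψ c γ B hB).2.1.2 (fun hj => hne (Prod.ext rfl hj))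
      · refine WaveletAux.orth_ne μ ?_ ((hψ c γ B hB).1 j) ((hψ c' γ' B' hB').1 j')
        intro he
        exact h (Subtype.ext (by rw [hB, hB']; exact he))
  · rw [Submodule.topologicalClosure_eq_top_iff, Submodule.eq_bot_iff]
    intro f hf
    rw [Submodule.mem_orthogonal] at hf
    apply WaveletAux.eq_zero μ f
    intro c γ
    rw [← WaveletAux.inner_ind]
    apply WaveletAux.inner_zero
    intro c γ h hh
    apply hf
    refine Submodule.span_mono ?_ ((hψ c γ ⟨_, c, γ, rfl⟩ rfl).2.2 h hh)
    rintro _ ⟨j, rfl⟩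
    exact ⟨(_, j), rfl⟩
end
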